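/- arXiv:math/0406591 — 5 statements merged into one kernel-verified Lean document; each statement's English description precedes it below -/
import Mathlib

section
/- There exist points q_1, …, q_13 ∈ ℂ² such that the ℂ-vector space of polynomials f ∈ ℂ[x,y] of total degree at most 22 that vanish to order at least 6 at each q_i has dimension exactly 3. (The linear system L_22(6^13) is non-special: C(24,2) − 13·C(7,2) = 276 − 273 = 3, so its projective dimension equals the expected dimension 2.) -/
open MvPolynomial

/-- The ideal of polynomials in `ℂ[x,y]` vanishing at the point `p ∈ ℂ²`;
`f` vanishes to order at least `m` at `p` iff `f ∈ (ptIdeal p) ^ m`. -/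
noncomputable def ptIdeal (p : ℂ × ℂ) : Ideal (MvPolynomial (Fin 2) ℂ) :=
  Ideal.span {X 0 - C p.1, X 1 - C p.2}

namespace FatPoints

/-!
The thirteen points are `(k, 2 ^ k)` for `k < 13`. The vanishing conditions are the Taylor
coefficients of order at most five at these points. They are shown to be linearly independent by
exhibiting a right inverse modulo `29` of the `273 × 276` matrix of conditions. The right inverse is
found by an elimination whose correctness is never used: only its output is checked.

Vectors modulo `29` are packed into the base `2 ^ 20` digits (lanes) of a natural number, so that
a vector operation is a single operation on natural numbers.
-/

/-! ### Forced evaluation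

The kernel evaluates by name. The following combinators are written with recursors so that numbers
are evaluated before they are passed on. -/

/-- Evaluate `n` before passing it to `k`. -/
def force {α : Type} (n : ℕ) (k : ℕ → α) : α :=
  n.rec (k 0) fun m _ => k m.succ

@[simp]
theorem force_eq {α : Type} (n : ℕ) (k : ℕ → α) : force n k = k n := by
  cases n <;> rfl

/-- `List.map`, in continuation passing style and with forced entries. -/
def forceMap {α β : Type} (f : α → ℕ) (l : List α) : (List ℕ → β) → β :=
  l.rec (fun k => k []) fun a _ ih k => force (f a) fun b => ih fun l' => k (b :: l')

@[simp]
theorem forceMap_eq {α β : Type} (f : α → ℕ) (l : List α) (k : List ℕ → β) :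
    forceMap f l k = k (l.map f) := by
  induction l generalizing k with
  | nil => rfl
  | cons a l ih =>
    change force (f a) (fun b => forceMap f l fun l' => k (b :: l')) = _
    simp [ih]

/-- The matrix with entries `f a b`, in continuation passing style and with forced entries. -/
def forceMatrix {α β γ : Type} (f : α → β → ℕ) (m : List β) (l : List α) :
    (List (List ℕ) → γ) → γ :=
  l.rec (fun k => k []) fun a _ ih k => forceMap (f a) m fun r => ih fun l' => k (r :: l')

@[simp]
theorem forceMatrix_eq {α β γ : Type} (f : α → β → ℕ) (m : List β) (l : List α)
    (k : List (List ℕ) → γ) : forceMatrix f m l k = k (l.map fun a => m.map (f a)) := by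
  induction l generalizing k with
  | nil => rfl
  | cons a l ih =>
    change forceMap (f a) m (fun r => forceMatrix f m l fun l' => k (r :: l')) = _
    simp [ih]

/-! ### Lanes -/

/-- The `k`-th digit of `n` in base `2 ^ 20`. -/
def lane (k n : ℕ) : ℕ := n / (2 ^ 20) ^ k % 2 ^ 20

theorem lane_zero (n : ℕ) : lane 0 n = n % 2 ^ 20 := by simp [lane]

theorem lane_succ (k n : ℕ) : lane (k + 1) n = lane k (n / 2 ^ 20) := by
  rw [lane, lane, Nat.div_div_eq_div_mul, ← pow_succ']

/-- The number with `n` lanes, all equal to `c`. -/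
def constLanes (c : ℕ) : ℕ → ℕ
  | 0 => 0
  | n + 1 => c + 2 ^ 20 * constLanes c n

theorem lane_constLanes_le {c : ℕ} (hc : c < 2 ^ 20) (n k : ℕ) : lane k (constLanes c n) ≤ c := by
  induction n generalizing k with
  | zero => simp [constLanes, lane]
  | succ n ih =>
    cases k with
    | zero => simpa [constLanes, lane_zero] using Nat.mod_le _ _
    | succ k =>
      rw [lane_succ, constLanes, Nat.add_mul_div_left _ _ (by norm_num), Nat.div_eq_of_lt hc,
        zero_add]
      exact ih k

theorem lane_and_le (k n m : ℕ) : lane k (n &&& m) ≤ lane k m := by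
  rw [lane, lane, ← pow_mul, ← Nat.shiftRight_eq_div_pow, ← Nat.shiftRight_eq_div_pow,
    Nat.shiftRight_and_distrib, Nat.and_mod_two_pow]
  exact Nat.and_le_right

theorem lane_le_of_and_eq {c n s : ℕ} (hc : c < 2 ^ 20) (h : s &&& constLanes c n = s) (k : ℕ) :
    lane k s ≤ c := by
  rw [← h]
  exact (lane_and_le _ _ _).trans (lane_constLanes_le hc _ _)

theorem lane_pow (k i : ℕ) : lane k ((2 ^ 20) ^ i) = if i = k then 1 else 0 := by
  induction k generalizing i with
  | zero =>
    rw [lane_zero]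
    cases i with
    | zero => rfl
    | succ i => simp [pow_succ]
  | succ k ih =>
    rw [lane_succ]
    cases i with
    | zero => simp [lane]
    | succ i => rw [pow_succ, Nat.mul_div_cancel _ (by norm_num), ih]; simp

/-- The dot product of two lists, truncated to the shorter one. -/
def dot : List ℕ → List ℕ → ℕ
  | a :: l, b :: m => a * b + dot l m
  | _, _ => 0

theorem dot_le {A B : ℕ} {l m : List ℕ} (hl : ∀ a ∈ l, a ≤ A) (hm : ∀ b ∈ m, b ≤ B) :
    dot l m ≤ l.length * (A * B) := by
  induction l generalizing m with
  | nil => simp [dot]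
  | cons a l ih =>
    cases m with
    | nil => simp [dot]
    | cons b m =>
      simp only [List.mem_cons, forall_eq_or_imp] at hl hm
      have := Nat.mul_le_mul hl.1 hm.1
      have := ih hl.2 hm.2
      rw [dot, List.length_cons, Nat.succ_mul]
      lia

theorem dot_eq_mod_add_div (l m : List ℕ) (w : ℕ) :
    dot l m = dot l (m.map (· % w)) + w * dot l (m.map (· / w)) := by
  induction l generalizing m with
  | nil => simp [dot]
  | cons a l ih =>
    cases m with
    | nil => simp [dot]
    | cons b m =>
      simp only [dot, List.map_cons]
      rw [ih m]
      nth_rewrite 1 [← Nat.mod_add_div b w]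
      ring

/-- Without overflow, the dot product is computed lane by lane. -/
theorem lane_dot {l m : List ℕ} (h : ∀ k, dot l (m.map (lane k)) < 2 ^ 20) (k : ℕ) :
    lane k (dot l m) = dot l (m.map (lane k)) := by
  have h0 : dot l (m.map (· % 2 ^ 20)) < 2 ^ 20 := by
    simpa only [← lane_zero] using h 0
  induction k generalizing m with
  | zero =>
    rw [lane_zero, dot_eq_mod_add_div l m (2 ^ 20), Nat.add_mul_mod_self_left,
      Nat.mod_eq_of_lt h0]
    simp only [← lane_zero]
  | succ k ih =>
    have hmap (k : ℕ) : (m.map (· / 2 ^ 20)).map (lane k) = m.map (lane (k + 1)) := by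
      simp [lane_succ]
    have h' (k : ℕ) : dot l ((m.map (· / 2 ^ 20)).map (lane k)) < 2 ^ 20 := by
      rw [hmap]; exact h _
    rw [lane_succ, dot_eq_mod_add_div l m (2 ^ 20), Nat.add_mul_div_left _ _ (by norm_num),
      Nat.div_eq_of_lt h0, zero_add, ih h', hmap]
    simpa only [← lane_zero] using h' 0

/-! ### The matrix of conditions -/

/-- The exponents of the monomials of degree at most `d` in two variables. -/
def exponents (d : ℕ) : List (ℕ × ℕ) :=
  (List.range (d + 1)).flatMap fun i => (List.range (d + 1 - i)).map fun j => (d - i - j, j)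

theorem mem_exponents {d : ℕ} {m : ℕ × ℕ} : m ∈ exponents d ↔ m.1 + m.2 ≤ d := by
  obtain ⟨a, b⟩ := m
  simp only [exponents, List.mem_flatMap, List.mem_map, List.mem_range, Prod.mk.injEq]
  constructor
  · rintro ⟨i, hi, j, hj, rfl, rfl⟩
    lia
  · intro h
    exact ⟨d - a - b, by lia, b, by lia, by lia, rfl⟩

/-- The coefficient of `X ^ a` in `(X + x) ^ i`, in a form that the kernel evaluates fast. -/
def taylor (x i a : ℕ) : ℕ := i.descFactorial a / a.factorial * x ^ (i - a)

theorem taylor_eq (x i a : ℕ) : taylor x i a = i.choose a * x ^ (i - a) := by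
  rw [taylor, Nat.choose_eq_descFactorial_div_factorial]

/-- The coefficient of `X ^ c.2.1 * Y ^ c.2.2` in the Taylor expansion of `X ^ m.1 * Y ^ m.2` at
`(c.1, 2 ^ c.1)`. -/
def taylorCoeff (c : ℕ × ℕ × ℕ) (m : ℕ × ℕ) : ℕ :=
  taylor c.1 m.1 c.2.1 * taylor (2 ^ c.1) m.2 c.2.2

/-- The conditions imposed by the thirteen sixfold points. -/
def conditions : List (ℕ × ℕ × ℕ) :=
  (List.range 13).flatMap fun k => (exponents 5).map fun m => (k, m)

theorem mem_conditions {c : ℕ × ℕ × ℕ} : c ∈ conditions ↔ c.1 < 13 ∧ c.2.1 + c.2.2 ≤ 5 := by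
  obtain ⟨k, m⟩ := c
  simp [conditions, mem_exponents]

theorem length_conditions : conditions.length = 273 := by decide +kernel

theorem length_exponents : (exponents 22).length = 276 := by decide +kernel

/-- The rows of the matrix of conditions modulo `29`. -/
def rows : List (List ℕ) :=
  conditions.map fun c => (exponents 22).map fun m => taylorCoeff c m % 29

/-! ### Elimination modulo `29` -/

/-- Reduce all lanes of `x` modulo `29`, for lanes that are not too large. -/
def reduceLanes (mask x : ℕ) : ℕ :=
  force x fun x => Nat.sub x (Nat.mul 29 (Nat.land (Nat.shiftRight (Nat.mul x 565) 14) mask))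

/-- Clear the lane of `s` at bit `c` by means of the row `r`, whose lane there is `1`. -/
def clearLane (mask c r s : ℕ) : ℕ :=
  reduceLanes mask (Nat.add s (Nat.mul (Nat.sub 29 (Nat.mod (Nat.shiftRight s c) 1048576)) r))

/-- Split off from `l` the first row with a nonzero lane at bit `c`. -/
def splitPivot {β : Type} (c : ℕ) (l : List ℕ) :
    (List ℕ → List ℕ) → β → (ℕ → List ℕ → β) → β :=
  l.rec (fun _ none _ => none) fun r l ih acc none some =>
    (Nat.mod (Nat.shiftRight r c) 1048576).rec (ih (fun t => acc (r :: t)) none some)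
      fun _ _ => some r (acc l)

/-- Gauss–Jordan elimination on the lowest `n` lanes; the result lists the pivot rows in the order
of their lanes, with `0` in place of a missing pivot. -/
def eliminate (mask n : ℕ) : List ℕ → List ℕ → (List ℕ → Bool) → Bool :=
  n.rec (fun _ done k => k done) fun n ih todo done k =>
    force (Nat.mul 20 n) fun c =>
    splitPivot c todo id (ih todo (0 :: done) k) fun r todo =>
    force (reduceLanes mask (Nat.mul r
      (Nat.mod (Nat.pow (Nat.mod (Nat.shiftRight r c) 1048576) 27) 29))) fun r =>
    forceMap (clearLane mask c r) todo fun todo =>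
    forceMap (clearLane mask c r) done fun done =>
    ih todo (r :: done) k

theorem splitPivot_cases {β : Type} (c : ℕ) (l : List ℕ) (acc : List ℕ → List ℕ) (x : β)
    (f : ℕ → List ℕ → β) :
    splitPivot c l acc x f = x ∨ ∃ r t, splitPivot c l acc x f = f r t := by
  induction l generalizing acc with
  | nil => exact .inl rfl
  | cons r l ih =>
    rcases h : Nat.mod (Nat.shiftRight r c) 1048576 with _ | n
    · have : splitPivot c (r :: l) acc x f = splitPivot c l (fun t => acc (r :: t)) x f := by
        change Nat.rec (motive := fun _ => β) (splitPivot c l (fun t => acc (r :: t)) x f)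
          (fun _ _ => f r (acc l)) (Nat.mod (Nat.shiftRight r c) 1048576) = _
        rw [h]; rfl
      rw [this]
      exact ih _
    · refine .inr ⟨r, acc l, ?_⟩
      change Nat.rec (motive := fun _ => β) (splitPivot c l (fun t => acc (r :: t)) x f)
        (fun _ _ => f r (acc l)) (Nat.mod (Nat.shiftRight r c) 1048576) = _
      rw [h]

theorem exists_of_eliminate {mask n : ℕ} {todo done : List ℕ} {k : List ℕ → Bool}
    (h : eliminate mask n todo done k = true) : ∃ l, k l = true := by
  induction n generalizing todo done with
  | zero => exact ⟨_, h⟩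
  | succ n ih =>
    change force (Nat.mul 20 n) (fun c => splitPivot c todo id
      (eliminate mask n todo (0 :: done) k) fun r todo =>
      force (reduceLanes mask (Nat.mul r
        (Nat.mod (Nat.pow (Nat.mod (Nat.shiftRight r c) 1048576) 27) 29))) fun r =>
      forceMap (clearLane mask c r) todo fun todo =>
      forceMap (clearLane mask c r) done fun done => eliminate mask n todo (r :: done) k) = true at h
    simp only [force_eq, forceMap_eq] at h
    rcases splitPivot_cases (Nat.mul 20 n) todo id (eliminate mask n todo (0 :: done) k) _ with
      h' | ⟨r, t, h'⟩
    all_goals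
      rw [h'] at h
      exact ih h

/-- Pack a list into the lanes of a number. -/
def pack : List ℕ → ℕ
  | [] => 0
  | a :: l => Nat.add a (Nat.mul 1048576 (pack l))

/-- Pack the rows of a matrix with `276` columns, followed by the rows of the identity matrix from
the `i`-th one on. -/
def augment : List (List ℕ) → ℕ → (List ℕ → Bool) → Bool
  | [], _, k => k []
  | r :: l, i, k =>
    force (Nat.add (pack r) (Nat.pow 2 (Nat.mul 20 (Nat.add 276 i)))) fun x =>
      augment l (i + 1) fun l' => k (x :: l')

theorem exists_of_augment {l : List (List ℕ)} {i : ℕ} {k : List ℕ → Bool}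
    (h : augment l i k = true) : ∃ l', k l' = true := by
  induction l generalizing i k with
  | nil => exact ⟨_, h⟩
  | cons r l ih =>
    simp only [augment, force_eq] at h
    obtain ⟨l', h⟩ := ih h
    exact ⟨_, h⟩

/-! ### Checking the right inverse -/

/-- The product of each row with `b` is, up to a multiple of `29` without overflow, the
corresponding row of the identity matrix, from the `i`-th one on. -/
def checkRows (mask : ℕ) (b : List ℕ) : List (List ℕ) → ℕ → Bool
  | [], _ => true
  | r :: l, i =>
    (force ((2 ^ 20) ^ i) fun e => force (dot r b) fun s => force ((s - e) / 29) fun q =>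
      Nat.beq (29 * q + e) s && Nat.beq (q &&& mask) q) && checkRows mask b l (i + 1)

/-- The rows of `b`, packed with small lanes, form a right inverse of `l` modulo `29`. -/
def isRightInverse (l : List (List ℕ)) (b : List ℕ) : Bool :=
  force (constLanes 31 273) fun mask => force (constLanes 16383 273) fun mask' =>
    (b.all fun n => Nat.beq (n &&& mask) n) && checkRows mask' b l 0

/-- Find a right inverse by elimination and check it. -/
def findRightInverse : Bool :=
  forceMatrix (fun c m => taylorCoeff c m % 29) (exponents 22) conditions fun l =>
    augment l 0 fun l' => force (constLanes 63 549) fun mask => eliminate mask 276 l' [] fun done =>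
      forceMap (fun n => Nat.shiftRight n 5520) done (isRightInverse l)

theorem findRightInverse_eq_true : findRightInverse = true := by decide +kernel

theorem exists_isRightInverse : ∃ b, isRightInverse rows b = true := by
  have h := findRightInverse_eq_true
  simp only [findRightInverse, forceMatrix_eq, force_eq, forceMap_eq] at h
  obtain ⟨_, h⟩ := exists_of_augment h
  obtain ⟨_, h⟩ := exists_of_eliminate h
  exact ⟨_, h⟩

theorem exists_of_checkRows {mask i : ℕ} {b : List ℕ} {l : List (List ℕ)}
    (h : checkRows mask b l i = true) (t : ℕ) (ht : t < l.length) :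
    ∃ q, 29 * q + (2 ^ 20) ^ (i + t) = dot l[t] b ∧ q &&& mask = q := by
  induction l generalizing i t with
  | nil => simp at ht
  | cons r l ih =>
    simp only [checkRows, force_eq, Bool.and_eq_true, Nat.beq_eq] at h
    cases t with
    | zero => exact ⟨_, h.1⟩
    | succ t =>
      have := ih h.2 t (by simpa using ht)
      rwa [add_assoc, add_comm 1 t] at this

/-- The lanes of a right inverse are its columns. -/
theorem dot_lane_of_isRightInverse {l : List (List ℕ)} {b : List ℕ} (h : isRightInverse l b = true)
    {i : ℕ} (hi : i < l.length) (hlen : l[i].length ≤ 276) (hle : ∀ a ∈ l[i], a ≤ 28) (k : ℕ) :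
    dot l[i] (b.map (lane k)) % 29 = if i = k then 1 else 0 := by
  simp only [isRightInverse, force_eq, Bool.and_eq_true, List.all_eq_true, Nat.beq_eq] at h
  obtain ⟨q, hq, hq'⟩ := exists_of_checkRows h.2 i hi
  rw [zero_add] at hq
  have hdot : ∀ k, dot l[i] (b.map (lane k)) < 2 ^ 20 := fun k => by
    refine (dot_le hle (B := 31) ?_).trans_lt ?_
    · simp only [List.forall_mem_map]
      exact fun n hn => lane_le_of_and_eq (by norm_num) (h.1 n hn) k
    · lia
  have hlane : ∀ k, dot [29, 1] ([q, (2 ^ 20) ^ i].map (lane k)) =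
      29 * lane k q + if i = k then 1 else 0 := fun k => by
    simp [dot, ← lane_pow]
  have hlane' : ∀ k, dot [29, 1] ([q, (2 ^ 20) ^ i].map (lane k)) < 2 ^ 20 := fun k => by
    have := lane_le_of_and_eq (by norm_num) hq' k
    rw [hlane]
    split_ifs <;> lia
  have hsum : dot l[i] b = dot [29, 1] [q, (2 ^ 20) ^ i] := by simp [dot, ← hq]
  rw [← lane_dot hdot, hsum, lane_dot hlane', hlane, Nat.mul_add_mod]
  split_ifs <;> rfl

/-! ### Vanishing orders and Taylor coefficients -/

/-- The translation of polynomials that moves the point `p` to the origin. -/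
noncomputable def translate (p : ℂ × ℂ) : MvPolynomial (Fin 2) ℂ ≃ₐ[ℂ] MvPolynomial (Fin 2) ℂ :=
  AlgEquiv.ofAlgHom (aeval ![X 0 + C p.1, X 1 + C p.2]) (aeval ![X 0 - C p.1, X 1 - C p.2])
    (by ext i : 1; fin_cases i <;> simp [← algebraMap_eq])
    (by ext i : 1; fin_cases i <;> simp [← algebraMap_eq])

theorem translate_X_zero (p : ℂ × ℂ) : translate p (X 0) = X 0 + C p.1 := by
  simp [translate]

theorem translate_X_one (p : ℂ × ℂ) : translate p (X 1) = X 1 + C p.2 := by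
  simp [translate]

theorem translate_C (p : ℂ × ℂ) (a : ℂ) : translate p (C a) = C a :=
  (translate p).commutes a

theorem map_translate_ptIdeal (p : ℂ × ℂ) :
    (ptIdeal p).map (translate p) = idealOfVars (Fin 2) ℂ := by
  rw [ptIdeal, Ideal.map_span, Set.image_pair, idealOfVars]
  congr 1
  ext f
  simp [translate_X_zero, translate_X_one, translate_C, Fin.exists_fin_two, eq_comm]

/-- The Taylor coefficient of `X ^ a * Y ^ b` at the point `p`. -/
noncomputable def taylorFunctional (p : ℂ × ℂ) (a b : ℕ) : MvPolynomial (Fin 2) ℂ →ₗ[ℂ] ℂ :=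
  lcoeff ℂ (Finsupp.single 0 a + Finsupp.single 1 b) ∘ₗ (translate p).toLinearMap

theorem taylorFunctional_apply (p : ℂ × ℂ) (a b : ℕ) (f : MvPolynomial (Fin 2) ℂ) :
    taylorFunctional p a b f =
      coeff (Finsupp.single 0 a + Finsupp.single 1 b) (translate p f) := rfl

theorem single_add_single_eq (s : Fin 2 →₀ ℕ) :
    Finsupp.single 0 (s 0) + Finsupp.single 1 (s 1) = s := by
  ext i
  fin_cases i <;> simp

theorem mem_ptIdeal_pow_iff {p : ℂ × ℂ} {n : ℕ} {f : MvPolynomial (Fin 2) ℂ} :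
    f ∈ ptIdeal p ^ n ↔ ∀ a b, a + b < n → taylorFunctional p a b f = 0 := by
  rw [← Ideal.apply_mem_of_equiv_iff (f := (translate p).toRingEquiv)]
  change translate p f ∈ Ideal.map (translate p) (ptIdeal p ^ n) ↔ _
  rw [Ideal.map_pow, map_translate_ptIdeal, mem_pow_idealOfVars_iff']
  constructor
  · intro h a b hab
    exact h _ (by simpa using hab)
  · intro h s hs
    have := h (s 0) (s 1) (by simpa [Finsupp.degree_eq_sum] using hs)
    rwa [taylorFunctional_apply, single_add_single_eq] at this

theorem X_add_C_pow (j : Fin 2) (x : ℂ) (i : ℕ) :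
    (X j + C x : MvPolynomial (Fin 2) ℂ) ^ i =
      ∑ k ∈ Finset.range (i + 1), monomial (Finsupp.single j k) (i.choose k * x ^ (i - k)) := by
  rw [add_pow]
  refine Finset.sum_congr rfl fun k _ => ?_
  rw [X_pow_eq_monomial, ← C_pow, mul_assoc, ← C_eq_coe_nat, ← C_mul, mul_comm, C_mul_monomial]
  simp [mul_comm]

theorem taylorFunctional_monomial (p : ℂ × ℂ) (a b i j : ℕ) :
    taylorFunctional p a b (X 0 ^ i * X 1 ^ j) =
      (i.choose a * p.1 ^ (i - a)) * (j.choose b * p.2 ^ (j - b)) := by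
  have hs (k l : ℕ) : (Finsupp.single 0 k + Finsupp.single 1 l : Fin 2 →₀ ℕ) =
      Finsupp.single 0 a + Finsupp.single 1 b ↔ l = b ∧ k = a := by
    simp [Finsupp.ext_iff, and_comm]
  rw [taylorFunctional_apply, map_mul, map_pow, map_pow, translate_X_zero, translate_X_one,
    X_add_C_pow, X_add_C_pow, Finset.sum_mul_sum]
  simp only [monomial_mul, coeff_sum, coeff_monomial, hs, ite_and, Finset.sum_ite_eq',
    Finset.mem_range]
  rcases lt_or_ge i a with hi | hi <;> rcases lt_or_ge j b with hj | hj <;>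
    simp [Nat.choose_eq_zero_of_lt, *]

/-- The polynomial with coefficients `l` at the monomials with exponents `ms`. -/
noncomputable def toPoly : List (ℕ × ℕ) → List ℕ → MvPolynomial (Fin 2) ℂ
  | m :: ms, a :: l => (a : ℂ) • (X 0 ^ m.1 * X 1 ^ m.2) + toPoly ms l
  | _, _ => 0

theorem toPoly_mem {d : ℕ} {ms : List (ℕ × ℕ)} (h : ∀ m ∈ ms, m.1 + m.2 ≤ d) (l : List ℕ) :
    toPoly ms l ∈ restrictTotalDegree (Fin 2) ℂ d := by
  induction ms generalizing l with
  | nil => simp [toPoly]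
  | cons m ms ih =>
    cases l with
    | nil => simp [toPoly]
    | cons a l =>
      simp only [List.mem_cons, forall_eq_or_imp] at h
      refine add_mem (Submodule.smul_mem _ _ ?_) (ih h.2 l)
      rw [mem_restrictTotalDegree]
      refine (totalDegree_mul _ _).trans ?_
      simpa [totalDegree_X_pow] using h.1

/-- The point `(k, 2 ^ k)`. -/
noncomputable def point (k : ℕ) : ℂ × ℂ := (k, 2 ^ k)

theorem taylorFunctional_toPoly (c : ℕ × ℕ × ℕ) (ms : List (ℕ × ℕ)) (l : List ℕ) :
    taylorFunctional (point c.1) c.2.1 c.2.2 (toPoly ms l) =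
      (dot (ms.map (taylorCoeff c)) l : ℂ) := by
  induction ms generalizing l with
  | nil => simp [toPoly, dot]
  | cons m ms ih =>
    cases l with
    | nil => simp [toPoly, dot]
    | cons a l =>
      rw [toPoly, map_add, ih, map_smul, taylorFunctional_monomial]
      simp [dot, taylorCoeff, taylor_eq, point, mul_comm]

theorem dot_map_mod (n : ℕ) (l m : List ℕ) : dot (l.map (· % n)) m ≡ dot l m [MOD n] := by
  induction l generalizing m with
  | nil => rfl
  | cons a l ih =>
    cases m with
    | nil => rfl
    | cons b m => exact ((Nat.mod_modEq a n).mul_right b).add (ih m)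

/-! ### The dimension count -/

/-- All Taylor coefficients that have to vanish. -/
noncomputable def conditionMap : MvPolynomial (Fin 2) ℂ →ₗ[ℂ] Fin conditions.length → ℂ :=
  LinearMap.pi fun i =>
    taylorFunctional (point conditions[i].1) conditions[i].2.1 conditions[i].2.2

theorem ker_conditionMap : LinearMap.ker conditionMap =
    ⨅ i : Fin 13, (ptIdeal (point i) ^ 6).restrictScalars ℂ := by
  ext f
  simp only [LinearMap.mem_ker, Submodule.mem_iInf, Submodule.restrictScalars_mem,
    mem_ptIdeal_pow_iff, funext_iff]
  constructor
  · intro h k a b hab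
    have hc : ((k : ℕ), a, b) ∈ conditions := mem_conditions.2 ⟨k.2, by lia⟩
    obtain ⟨i, hi, hik⟩ := List.mem_iff_getElem.1 hc
    simpa [conditionMap, hik] using h ⟨i, hi⟩
  · intro h i
    have hc := mem_conditions.1 (List.getElem_mem i.2)
    exact h ⟨_, hc.1⟩ _ _ (Nat.lt_succ_of_le hc.2)

theorem getElem_rows {i : ℕ} (hi : i < conditions.length) (hi' : i < rows.length) :
    rows[i]'hi' = ((exponents 22).map (taylorCoeff (conditions[i]'hi))).map (· % 29) := by
  simp [rows]

theorem exists_map_cast_eq_one : ∃ N : Matrix (Fin conditions.length) (Fin conditions.length) ℕ,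
    N.map (Nat.cast : ℕ → ZMod 29) = 1 ∧
      ∀ k, ∃ f ∈ restrictTotalDegree (Fin 2) ℂ 22, ∀ i, conditionMap f i = N i k := by
  obtain ⟨b, hb⟩ := exists_isRightInverse
  refine ⟨.of fun i k => dot ((exponents 22).map (taylorCoeff conditions[i])) (b.map (lane k)), ?_,
    fun k => ⟨toPoly (exponents 22) (b.map (lane k)),
      toPoly_mem (fun m hm => mem_exponents.1 hm) _, fun i => ?_⟩⟩
  swap
  · rw [conditionMap, LinearMap.pi_apply, taylorFunctional_toPoly, Matrix.of_apply]
  ext i k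
  have hi : (i : ℕ) < rows.length := by simp [rows]
  have hrow := getElem_rows i.2 hi
  have h := dot_lane_of_isRightInverse hb hi (by simp [hrow, length_exponents])
    (by
      simp only [hrow, List.forall_mem_map]
      exact fun m _ => Nat.le_of_lt_succ (Nat.mod_lt _ (by norm_num))) k
  rw [hrow, dot_map_mod] at h
  rw [Matrix.map_apply, Matrix.of_apply, ← ZMod.natCast_mod, Fin.getElem_fin, h, Matrix.one_apply]
  simp [Fin.ext_iff]

theorem det_cast_ne_zero {n p : ℕ} [Fact p.Prime] {N : Matrix (Fin n) (Fin n) ℕ}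
    (h : N.map (Nat.cast : ℕ → ZMod p) = 1) : (N.map (Nat.cast : ℕ → ℂ)).det ≠ 0 := by
  let M : Matrix (Fin n) (Fin n) ℤ := N.map Nat.cast
  have hp : (Int.castRingHom (ZMod p)).mapMatrix M = 1 := by
    rw [← h]; ext; simp [M]
  have hc : (Int.castRingHom ℂ).mapMatrix M = N.map Nat.cast := by
    ext; simp [M]
  have hdet : M.det ≠ 0 := fun h0 => by
    have := RingHom.map_det (Int.castRingHom (ZMod p)) M
    simp [h0, hp] at this
  rw [← hc, ← RingHom.map_det]
  simpa using hdet

theorem map_conditionMap_eq_top :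
    (restrictTotalDegree (Fin 2) ℂ 22).map conditionMap = ⊤ := by
  obtain ⟨N, hN, hf⟩ := exists_map_cast_eq_one
  have : Fact (Nat.Prime 29) := ⟨by norm_num⟩
  choose f hf hfN using hf
  have hunit : IsUnit (N.map (Nat.cast : ℕ → ℂ)) :=
    (Matrix.isUnit_iff_isUnit_det _).2 (det_cast_ne_zero hN).isUnit
  rw [eq_top_iff]
  intro v _
  obtain ⟨w, rfl⟩ := Matrix.mulVec_surjective_iff_isUnit.2 hunit v
  refine ⟨∑ k, w k • f k, sum_mem fun k _ => Submodule.smul_mem _ _ (hf k), ?_⟩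
  ext i
  simp [hfN, Matrix.mulVec, dotProduct, mul_comm]

theorem finrank_restrictTotalDegree :
    Module.finrank ℂ (restrictTotalDegree (Fin 2) ℂ 22) = 276 := by
  let e : {s : Fin 2 →₀ ℕ | (s.sum fun _ a => a) ≤ 22} ≃ (exponents 22).toFinset :=
    (Finsupp.equivFunOnFinite.trans (finTwoArrowEquiv ℕ)).subtypeEquiv fun s => by
      simp [mem_exponents, Finsupp.sum_fintype]
  rw [restrictTotalDegree, Module.finrank_eq_nat_card_basis (basisRestrictSupport ℂ _),
    Nat.card_congr e, Nat.card_eq_fintype_card, Fintype.card_coe]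
  decide +kernel

theorem finrank_inf_ker_conditionMap :
    Module.finrank ℂ ↥(restrictTotalDegree (Fin 2) ℂ 22 ⊓ LinearMap.ker conditionMap) = 3 := by
  have h := (conditionMap.domRestrict
    (restrictTotalDegree (Fin 2) ℂ 22)).finrank_range_add_finrank_ker
  rw [LinearMap.ker_domRestrict, LinearMap.range_domRestrict, map_conditionMap_eq_top,
    finrank_top, Module.finrank_fin_fun, finrank_restrictTotalDegree] at h
  rw [← Submodule.map_comap_subtype, Submodule.finrank_map_subtype_eq]
  have := length_conditions
  lia

end FatPoints

theorem L22_6p13_nonspecial :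
    ∃ q : Fin 13 → ℂ × ℂ,
      Module.finrank ℂ
        ↥(MvPolynomial.restrictTotalDegree (Fin 2) ℂ 22 ⊓
          ⨅ i, (ptIdeal (q i) ^ 6).restrictScalars ℂ) = 3 := by
  refine ⟨fun i => FatPoints.point i, ?_⟩
  rw [← FatPoints.ker_conditionMap]
  exact FatPoints.finrank_inf_ker_conditionMap
end

section
/- There exist points p, q_1, …, q_13 ∈ ℂ² such that the only polynomial f ∈ ℂ[x,y] of total degree at most 11 that vanishes at p and vanishes to order at least 3 at each q_i is the zero polynomial. (The linear system L_11(1, 3^13) is empty; note the number of imposed conditions 1 + 13·C(4,2) = 79 exceeds C(13,2) = 78.) -/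
open MvPolynomial

namespace PlaneCurve

section Field

variable {K : Type*} [Field K]

/-- The expansion of `f` at `p`: it sends `f(x, y)` to `f(p.1 + T x, p.2 + T y)`, as a polynomial
in `T`. The multiplicity of `f` at `p` is the exponent of `T` in it. -/
noncomputable def expansion (p : K × K) :
    MvPolynomial (Fin 2) K →ₐ[K] Polynomial (MvPolynomial (Fin 2) K) :=
  aeval ![Polynomial.C (C p.1) + Polynomial.X * Polynomial.C (X 0),
    Polynomial.C (C p.2) + Polynomial.X * Polynomial.C (X 1)]

/-- The equation of the line `l.1 * x + l.2.1 * y = l.2.2`. -/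
noncomputable def linePoly (l : K × K × K) : MvPolynomial (Fin 2) K :=
  C l.1 * X 0 + C l.2.1 * X 1 - C l.2.2

theorem expansion_linePoly {l : K × K × K} {p : K × K} (h : l.1 * p.1 + l.2.1 * p.2 = l.2.2) :
    expansion p (linePoly l) =
      Polynomial.X * Polynomial.C (C l.1 * X 0 + C l.2.1 * X 1) := by
  simp only [expansion, linePoly, map_add, map_sub, map_mul, aeval_X, algHom_C, ← h,
    Polynomial.algebraMap_apply, algebraMap_eq, Matrix.cons_val_zero, Matrix.cons_val_one]
  ring

theorem linearForm_ne_zero {a b : K} (h : a ≠ 0 ∨ b ≠ 0) :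
    (C a * X 0 + C b * X 1 : MvPolynomial (Fin 2) K) ≠ 0 := by
  intro h0
  have ha := congrArg (eval ![1, 0]) h0
  have hb := congrArg (eval ![0, 1]) h0
  simp at ha hb
  tauto

theorem X_pow_dvd_expansion_of_linePoly_mul_of_mem {l : K × K × K} (hl : l.1 ≠ 0 ∨ l.2.1 ≠ 0)
    {p : K × K} (h : l.1 * p.1 + l.2.1 * p.2 = l.2.2) {g : MvPolynomial (Fin 2) K} {m : ℕ}
    (hm : Polynomial.X ^ m ∣ expansion p (linePoly l * g)) :
    Polynomial.X ^ (m - 1) ∣ expansion p g := by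
  obtain _ | m := m
  · simp
  rw [map_mul, expansion_linePoly h, pow_succ', mul_assoc,
    mul_dvd_mul_iff_left Polynomial.X_ne_zero] at hm
  refine Polynomial.prime_X.pow_dvd_of_dvd_mul_left m ?_ hm
  rw [Polynomial.X_dvd_iff, Polynomial.coeff_C_zero]
  exact linearForm_ne_zero hl

theorem X_pow_dvd_expansion_of_linePoly_mul_of_notMem {l : K × K × K}
    {p : K × K} (h : l.1 * p.1 + l.2.1 * p.2 ≠ l.2.2) {g : MvPolynomial (Fin 2) K} {m : ℕ}
    (hm : Polynomial.X ^ m ∣ expansion p (linePoly l * g)) :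
    Polynomial.X ^ m ∣ expansion p g := by
  rw [map_mul] at hm
  refine Polynomial.prime_X.pow_dvd_of_dvd_mul_left m ?_ hm
  rw [Polynomial.X_dvd_iff]
  intro h0
  apply h
  have := congrArg (eval 0) h0
  simp [expansion, linePoly, Polynomial.coeff_zero_eq_eval_zero, Polynomial.algebraMap_apply,
    sub_eq_zero] at this
  exact this

theorem totalDegree_linePoly_pos {l : K × K × K} (hl : l.1 ≠ 0 ∨ l.2.1 ≠ 0) :
    0 < (linePoly l).totalDegree := by
  rw [Nat.pos_iff_ne_zero, Ne, totalDegree_eq_zero_iff_eq_C]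
  intro h
  have h0 := congrArg (eval ![0, 0]) h
  have ha := congrArg (eval ![1, 0]) h
  have hb := congrArg (eval ![0, 1]) h
  simp only [eval_C] at h0 ha hb
  rw [← h0] at ha hb
  simp [linePoly] at ha hb
  tauto

/-- A polynomial whose multiplicities at distinct points of a line add up to more than its degree
is divisible by the equation of the line. -/
theorem linePoly_dvd {ι : Type*} {P : ι → K × K} (hP : Function.Injective P) {l : K × K × K}
    (hl : l.1 ≠ 0 ∨ l.2.1 ≠ 0) {S : Finset ι}
    (hS : ∀ i ∈ S, l.1 * (P i).1 + l.2.1 * (P i).2 = l.2.2) {m : ι → ℕ}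
    {f : MvPolynomial (Fin 2) K} (hd : f.totalDegree < ∑ i ∈ S, m i)
    (hf : ∀ i ∈ S, Polynomial.X ^ m i ∣ expansion (P i) f) : linePoly l ∣ f := by
  obtain ⟨a, b, c⟩ := l
  dsimp only at hl hS
  -- `u * x + v * y` is an affine coordinate on the line
  obtain ⟨u, v, huv⟩ : ∃ u v, u * b - v * a = 1 := by
    rcases hl with h | h
    · exact ⟨0, -a⁻¹, by simp [h]⟩
    · exact ⟨b⁻¹, 0, by simp [h]⟩
  let s : ι → K := fun i ↦ u * (P i).1 + v * (P i).2
  have hx : ∀ i ∈ S, (P i).1 = b * s i - v * c := fun i hi ↦ by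
    linear_combination (-(P i).1) * huv - v * hS i hi
  have hy : ∀ i ∈ S, (P i).2 = u * c - a * s i := fun i hi ↦ by
    linear_combination (-(P i).2) * huv + u * hS i hi
  let r : MvPolynomial (Fin 2) K →ₐ[K] Polynomial K :=
    aeval ![Polynomial.C b * Polynomial.X - Polynomial.C (v * c),
      Polynomial.C (u * c) - Polynomial.C a * Polynomial.X]
  have hr : ∀ i ∈ S, (Polynomial.X - Polynomial.C (s i)) ^ m i ∣ r f := fun i hi ↦ by
    let φ : Polynomial (MvPolynomial (Fin 2) K) →+* Polynomial K :=
      Polynomial.eval₂RingHom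
        (aeval ![Polynomial.C b, Polynomial.C (-a)] :
          MvPolynomial (Fin 2) K →ₐ[K] Polynomial K).toRingHom
        (Polynomial.X - Polynomial.C (s i))
    have hφ : φ.comp (expansion (P i)).toRingHom = r.toRingHom := by
      apply MvPolynomial.ringHom_ext
      · intro k
        simp [φ, r, expansion, Polynomial.algebraMap_apply]
      · intro j
        fin_cases j
        · simp [φ, r, expansion, hx i hi]
          ring
        · simp [φ, r, expansion, hy i hi]
          ring
    have hdvd := map_dvd φ (hf i hi)
    have hcomp : φ (expansion (P i) f) = r f := congrArg (fun ψ ↦ ψ f) hφ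
    rw [hcomp, map_pow] at hdvd
    simpa [φ] using hdvd
  have hprod : ∏ i ∈ S, (Polynomial.X - Polynomial.C (s i)) ^ m i ∣ r f := by
    refine Finset.prod_dvd_of_coprime (fun i hi j hj hij ↦ ?_) hr
    refine (Polynomial.isCoprime_X_sub_C_of_isUnit_sub ?_).pow
    refine (sub_ne_zero.2 fun h ↦ hij (hP (Prod.ext ?_ ?_))).isUnit
    · rw [hx i hi, hx j hj, h]
    · rw [hy i hi, hy j hj, h]
  have hr0 : r f = 0 := by
    refine Polynomial.eq_zero_of_dvd_of_natDegree_lt hprod ?_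
    rw [Polynomial.natDegree_prod_of_monic _ _ fun i _ ↦ (Polynomial.monic_X_sub_C _).pow _]
    simp only [Polynomial.natDegree_pow, Polynomial.natDegree_X_sub_C, mul_one]
    refine lt_of_le_of_lt ?_ hd
    rw [← mul_one f.totalDegree]
    refine aeval_natDegree_le f le_rfl _ fun j ↦ ?_
    fin_cases j <;> dsimp <;> compute_degree
  -- modulo the line, `f` is the pullback of `r f` along the coordinate
  let t : MvPolynomial (Fin 2) K := C u * X 0 + C v * X 1
  have key : (Ideal.Quotient.mkₐ K (Ideal.span {linePoly (a, b, c)})) =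
      ((Ideal.Quotient.mkₐ K (Ideal.span {linePoly (a, b, c)})).comp
        (Polynomial.aeval t)).comp r := by
    apply MvPolynomial.algHom_ext
    intro j
    have huv' : (C u * C b - C v * C a : MvPolynomial (Fin 2) K) = 1 := by
      rw [← C_mul, ← C_mul, ← C_sub, huv, C_1]
    rw [AlgHom.comp_apply, AlgHom.comp_apply]
    simp only [Ideal.Quotient.mkₐ_eq_mk]
    rw [Ideal.Quotient.mk_eq_mk_iff_sub_mem, Ideal.mem_span_singleton]
    fin_cases j
    · refine ⟨-C v, ?_⟩
      simp [r, t, linePoly, algebraMap_eq]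
      linear_combination (-X 0) * huv'
    · refine ⟨C u, ?_⟩
      simp [r, t, linePoly, algebraMap_eq]
      linear_combination (-X 1) * huv'
  have hq := congrArg (fun ψ ↦ ψ f) key
  simp only [AlgHom.comp_apply, hr0, map_zero, Ideal.Quotient.mkₐ_eq_mk] at hq
  rwa [Ideal.Quotient.eq_zero_iff_mem, Ideal.mem_span_singleton] at hq

end Field

/-- The incidence of the integral point `p` with the line `l.1 * x + l.2.1 * y = l.2.2`. -/
abbrev OnLine (l : ℤ × ℤ × ℤ) (p : ℤ × ℤ) : Prop := l.1 * p.1 + l.2.1 * p.2 = l.2.2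

/-- The multiplicities left at the points `P` after splitting off the line `l`. -/
def residual {n : ℕ} (P : Fin n → ℤ × ℤ) (l : ℤ × ℤ × ℤ) (m : Fin n → ℕ) (i : Fin n) : ℕ :=
  if OnLine l (P i) then m i - 1 else m i

/-- The lines of the list split off, one after the other, from every curve of degree less than the
length of the list that has multiplicities `m` at the points `P`, because at each stage the
multiplicities on the line add up to more than the degree. -/
def SplitOff {n : ℕ} (P : Fin n → ℤ × ℤ) : List (ℤ × ℤ × ℤ) → (Fin n → ℕ) → Prop
  | [], _ => True
  | l :: L, m => (l.1 ≠ 0 ∨ l.2.1 ≠ 0) ∧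
      L.length < (∑ i with OnLine l (P i), m i) ∧ SplitOff P L (residual P l m)

instance {n : ℕ} (P : Fin n → ℤ × ℤ) : ∀ L m, Decidable (SplitOff P L m)
  | [], _ => inferInstanceAs (Decidable True)
  | l :: L, m =>
    have : Decidable (SplitOff P L (residual P l m)) := instDecidableSplitOff P L _
    inferInstanceAs (Decidable (_ ∧ _ ∧ _))

theorem eq_zero_of_splitOff {K : Type*} [Field K] [CharZero K] {n : ℕ} {P : Fin n → ℤ × ℤ}
    (hP : Function.Injective P) {L : List (ℤ × ℤ × ℤ)} {m : Fin n → ℕ} (hL : SplitOff P L m)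
    {f : MvPolynomial (Fin 2) K} (hd : f.totalDegree < L.length)
    (hf : ∀ i, Polynomial.X ^ m i ∣ expansion (((P i).1 : K), ((P i).2 : K)) f) : f = 0 := by
  induction L generalizing m f with
  | nil => simp at hd
  | cons l L ih =>
    obtain ⟨hl, hsum, hL⟩ := hL
    let l' : K × K × K := (l.1, l.2.1, l.2.2)
    have hl' : l'.1 ≠ 0 ∨ l'.2.1 ≠ 0 := by simpa [l'] using hl
    have hmem (i) : OnLine l (P i) ↔ l'.1 * (P i).1 + l'.2.1 * (P i).2 = l'.2.2 := by
      simp only [l', OnLine]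
      norm_cast
    have hinj : Function.Injective fun i ↦ (((P i).1 : K), ((P i).2 : K)) := fun i j h ↦ by
      apply hP
      simpa [Prod.ext_iff] using h
    rw [List.length_cons] at hd
    obtain ⟨g, rfl⟩ : linePoly l' ∣ f :=
      linePoly_dvd hinj hl' (S := {i | OnLine l (P i)}) (by simp [hmem])
        (by lia) fun i _ ↦ hf i
    by_cases hg : g = 0
    · simp [hg]
    have hpos := totalDegree_linePoly_pos hl'
    have hl0 : linePoly l' ≠ 0 := fun h ↦ by simp [h] at hpos
    rw [totalDegree_mul_of_isDomain hl0 hg] at hd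
    refine absurd (ih hL (by lia) fun i ↦ ?_) hg
    unfold residual
    split_ifs with hi
    · exact X_pow_dvd_expansion_of_linePoly_mul_of_mem hl' ((hmem i).1 hi) (hf i)
    · exact X_pow_dvd_expansion_of_linePoly_mul_of_notMem (mt (hmem i).2 hi) (hf i)

theorem X_pow_dvd_expansion_of_mem_ptIdeal_pow {p : ℂ × ℂ} {m : ℕ} {f : MvPolynomial (Fin 2) ℂ}
    (hf : f ∈ ptIdeal p ^ m) : Polynomial.X ^ m ∣ expansion p f := by
  rw [← Ideal.mem_span_singleton, ← Ideal.span_singleton_pow]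
  have h := Ideal.mem_map_of_mem (expansion p) hf
  rw [Ideal.map_pow] at h
  refine Ideal.pow_right_mono ?_ m h
  rw [ptIdeal, Ideal.map_span, Ideal.span_le]
  rintro _ ⟨x, rfl | rfl, rfl⟩ <;>
    simp [expansion, Ideal.mem_span_singleton, Polynomial.algebraMap_apply, algebraMap_eq]

/-- The simple point, followed by the thirteen triple points. -/
def points : Fin 14 → ℤ × ℤ :=
  ![(1, 0), (1, 2), (2, 1), (3, 0), (4, 4), (4, 0), (1, 1), (3, 4), (0, 1), (0, 0), (4, 1), (3, 2),
    (2, 2), (4, 2)]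

/-- The lines that split off, as coefficients of equations `a * x + b * y = c`. -/
def lines : List (ℤ × ℤ × ℤ) :=
  [(0, 1, 2), (0, 1, 1), (0, 1, 0), (1, 0, 4), (1, -1, 0), (1, -1, -1), (1, 0, 3), (0, 1, 1),
    (0, 1, 2), (0, 1, 0), (3, -2, 4), (1, -1, -1)]

theorem splitOff_lines : SplitOff points lines (Fin.cons 1 fun _ ↦ 3) := by
  decide +kernel

end PlaneCurve

open PlaneCurve in
theorem L11_1_3p13_empty :
    ∃ (p : ℂ × ℂ) (q : Fin 13 → ℂ × ℂ),
      ∀ f : MvPolynomial (Fin 2) ℂ, f.totalDegree ≤ 11 →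
        f ∈ ptIdeal p → (∀ i, f ∈ ptIdeal (q i) ^ 3) → f = 0 := by
  refine ⟨((points 0).1, (points 0).2), fun i ↦ ((points i.succ).1, (points i.succ).2),
    fun f hd hp hq ↦ eq_zero_of_splitOff (P := points) (by decide +kernel) splitOff_lines
      (Nat.lt_succ_of_le hd) fun i ↦ X_pow_dvd_expansion_of_mem_ptIdeal_pow ?_⟩
  cases i using Fin.cases with
  | zero => simpa using hp
  | succ i => simpa using hq i
end

section
/- There exist points p, q_1, …, q_10 ∈ ℂ² such that the only polynomial f ∈ ℂ[x,y] of total degree at most 16 that vanishes to order at least 2 at p and to order at least 5 at each q_i is the zero polynomial. (The linear system L_16(2, 5^10) is empty and non-special; note C(18,2) = C(3,2) + 10·C(6,2) = 153.) -/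
open MvPolynomial

/-- The substitution `f(x, y) ↦ f(x + q₁, y + q₂)`, which moves the point `q` to the origin. -/
noncomputable def translateBy (q : ℂ × ℂ) :
    MvPolynomial (Fin 2) ℂ →ₐ[ℂ] MvPolynomial (Fin 2) ℂ :=
  aeval ![X 0 + C q.1, X 1 + C q.2]

/-- The exponent vector of the monomial `x ^ i * y ^ j`. -/
noncomputable def expVec (m : ℕ × ℕ) : Fin 2 →₀ ℕ :=
  Finsupp.single 0 m.1 + Finsupp.single 1 m.2

@[simp] lemma expVec_zero (m : ℕ × ℕ) : expVec m 0 = m.1 := by simp [expVec]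

@[simp] lemma expVec_one (m : ℕ × ℕ) : expVec m 1 = m.2 := by simp [expVec]

lemma expVec_injective : Function.Injective expVec := fun m n h =>
  Prod.ext (by simpa using DFunLike.congr_fun h 0) (by simpa using DFunLike.congr_fun h 1)

lemma expVec_apply_pair (d : Fin 2 →₀ ℕ) : expVec (d 0, d 1) = d := by
  ext i
  fin_cases i <;> simp

lemma degree_expVec (m : ℕ × ℕ) : (expVec m).degree = m.1 + m.2 := by
  simp [Finsupp.degree_eq_sum]

lemma monomial_expVec (m : ℕ × ℕ) (a : ℂ) :
    monomial (expVec m) a = C a * (X 0 ^ m.1 * X 1 ^ m.2) := by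
  rw [monomial_eq, Finsupp.prod_fintype _ _ (by simp)]
  simp

lemma translateBy_mem_pow {q : ℂ × ℂ} {n : ℕ} {f : MvPolynomial (Fin 2) ℂ}
    (hf : f ∈ ptIdeal q ^ n) : translateBy q f ∈ idealOfVars (Fin 2) ℂ ^ n := by
  have hX (i : Fin 2) : (X i : MvPolynomial (Fin 2) ℂ) ∈ idealOfVars (Fin 2) ℂ :=
    Ideal.subset_span ⟨i, rfl⟩
  have hle : (ptIdeal q).map (translateBy q) ≤ idealOfVars (Fin 2) ℂ := by
    rw [ptIdeal, Ideal.map_span, Ideal.span_le]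
    rintro _ ⟨g, rfl | rfl, rfl⟩
    · simpa [translateBy] using hX 0
    · simpa [translateBy] using hX 1
  have h := Ideal.mem_map_of_mem (translateBy q) hf
  rw [Ideal.map_pow] at h
  exact Ideal.pow_right_mono hle n h

lemma coeff_translateBy_eq_zero {q : ℂ × ℂ} {n : ℕ} {f : MvPolynomial (Fin 2) ℂ}
    (hf : f ∈ ptIdeal q ^ n) {k l : ℕ} (h : k + l < n) :
    coeff (expVec (k, l)) (translateBy q f) = 0 := by
  have h' := (mem_pow_idealOfVars_iff' _ _).1 (translateBy_mem_pow hf)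
  exact h' _ (by rwa [degree_expVec])

lemma coeff_mul_pow_add_C (x y : ℂ) (i j k l : ℕ) :
    coeff (expVec (k, l)) ((X 0 + C x) ^ i * (X 1 + C y) ^ j : MvPolynomial (Fin 2) ℂ) =
      i.choose k * j.choose l * (x ^ (i - k) * y ^ (j - l)) := by
  have key : ((X 0 + C x) ^ i * (X 1 + C y) ^ j : MvPolynomial (Fin 2) ℂ) =
      ∑ m ∈ Finset.range (i + 1) ×ˢ Finset.range (j + 1), monomial (expVec m)
        (i.choose m.1 * j.choose m.2 * (x ^ (i - m.1) * y ^ (j - m.2))) := by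
    rw [add_pow, add_pow, Finset.sum_mul_sum, ← Finset.sum_product']
    refine Finset.sum_congr rfl fun m _ => ?_
    rw [monomial_expVec]
    simp only [map_mul, map_pow, map_natCast]
    ring
  rw [key, coeff_sum]
  simp only [coeff_monomial, expVec_injective.eq_iff]
  rw [Finset.sum_ite_eq']
  split_ifs with h
  · rfl
  · simp only [Finset.mem_product, Finset.mem_range, not_and_or, not_lt, Nat.succ_le_iff] at h
    rcases h with h | h <;> simp [Nat.choose_eq_zero_of_lt h]

/-- The exponents of the monomials of degree at most `d`. -/
def exponents (d : ℕ) : Finset (ℕ × ℕ) :=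
  (Finset.range (d + 1) ×ˢ Finset.range (d + 1)).filter fun m => m.1 + m.2 ≤ d

lemma mem_exponents {d : ℕ} {m : ℕ × ℕ} : m ∈ exponents d ↔ m.1 + m.2 ≤ d := by
  simp only [exponents, Finset.mem_filter, Finset.mem_product, Finset.mem_range]
  omega

lemma eq_sum_exponents {d : ℕ} {f : MvPolynomial (Fin 2) ℂ} (hf : f.totalDegree ≤ d) :
    f = ∑ m ∈ exponents d, monomial (expVec m) (coeff (expVec m) f) := by
  ext n
  obtain ⟨m, rfl⟩ : ∃ m, expVec m = n := ⟨_, expVec_apply_pair n⟩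
  rw [coeff_sum]
  simp only [coeff_monomial, expVec_injective.eq_iff]
  rw [Finset.sum_ite_eq']
  split_ifs with h
  · rfl
  · rw [mem_exponents, not_le] at h
    apply coeff_eq_zero_of_totalDegree_lt
    have := degree_expVec m
    rw [Finsupp.degree_apply] at this
    omega

lemma coeff_translateBy {d : ℕ} {f : MvPolynomial (Fin 2) ℂ} (hf : f.totalDegree ≤ d)
    (q : ℂ × ℂ) (k l : ℕ) :
    coeff (expVec (k, l)) (translateBy q f) = ∑ m ∈ exponents d, coeff (expVec m) f *
      (m.1.choose k * m.2.choose l * (q.1 ^ (m.1 - k) * q.2 ^ (m.2 - l))) := by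
  conv_lhs => rw [eq_sum_exponents hf]
  rw [map_sum, coeff_sum]
  refine Finset.sum_congr rfl fun m _ => ?_
  rw [monomial_expVec, map_mul, map_mul, map_pow, map_pow, ← coeff_mul_pow_add_C]
  simp [translateBy, algebraMap_eq, coeff_C_mul]

lemma IsPrimitiveRoot.sum_range_pow_mul {ζ : ℂ} {n : ℕ} (hζ : IsPrimitiveRoot ζ n) (e : ℕ) :
    ∑ s ∈ Finset.range n, ζ ^ (s * e) = if n ∣ e then (n : ℂ) else 0 := by
  simp only [mul_comm _ e, pow_mul]
  split_ifs with h
  · simp [(hζ.pow_eq_one_iff_dvd e).2 h]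
  · have hne : ζ ^ e - 1 ≠ 0 := sub_ne_zero.2 fun h' => h ((hζ.pow_eq_one_iff_dvd e).1 h')
    refine (mul_eq_zero.1 ?_).resolve_left hne
    rw [mul_geom_sum, ← pow_mul, mul_comm, pow_mul, hζ.pow_eq_one, one_pow, sub_self]

/-- The coefficient of `m` in the order-`(k, l)` condition at the point `(1, t)`;
here `b = (t, k, l)`. -/
def condCoeff (b : ℕ × ℕ × ℕ) (m : ℕ × ℕ) : ℕ :=
  m.1.choose b.2.1 * m.2.choose b.2.2 * b.1 ^ (m.2 - b.2.2)

/-- Vanishing on an orbit of `(x, y) ↦ (ζ x, ζ² y)` splits along the isotypic components. -/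
lemma sum_isotypic_eq_zero {ζ : ℂ} (hζ : IsPrimitiveRoot ζ 5) (S : Finset (ℕ × ℕ))
    (a : ℕ × ℕ → ℂ) (t k l : ℕ)
    (h : ∀ s < 5, ∑ m ∈ S, a m * (m.1.choose k * m.2.choose l *
      ((ζ ^ s) ^ (m.1 - k) * (t * ζ ^ (2 * s)) ^ (m.2 - l))) = 0) {c : ℕ} (hc : c < 5) :
    ∑ m ∈ S with (m.1 + 2 * m.2) % 5 = c, condCoeff (t, k, l) m * a m = 0 := by
  have hs : ∀ s < 5, ∑ m ∈ S, condCoeff (t, k, l) m * a m * ζ ^ (s * (m.1 + 2 * m.2)) = 0 := by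
    intro s hs
    rw [← mul_zero (ζ ^ (s * (k + 2 * l))), ← h s hs, Finset.mul_sum]
    refine Finset.sum_congr rfl fun m _ => ?_
    rcases lt_or_ge m.1 k with hk | hk
    · simp [condCoeff, Nat.choose_eq_zero_of_lt hk]
    rcases lt_or_ge m.2 l with hl | hl
    · simp [condCoeff, Nat.choose_eq_zero_of_lt hl]
    obtain ⟨u, hu⟩ := Nat.exists_eq_add_of_le hk
    obtain ⟨v, hv⟩ := Nat.exists_eq_add_of_le hl
    simp only [condCoeff, hu, hv, Nat.add_sub_cancel_left]
    push_cast
    ring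
  have hsum : ∑ m ∈ S, condCoeff (t, k, l) m * a m *
      ∑ s ∈ Finset.range 5, ζ ^ (s * (m.1 + 2 * m.2 + 4 * c)) = 0 := by
    simp only [Finset.mul_sum]
    rw [Finset.sum_comm]
    refine Finset.sum_eq_zero fun s hs5 => ?_
    rw [← zero_mul (ζ ^ (s * (4 * c))), ← hs s (Finset.mem_range.1 hs5), Finset.sum_mul]
    refine Finset.sum_congr rfl fun m _ => ?_
    rw [mul_add s _ (4 * c), pow_add, ← mul_assoc]
  rw [Finset.sum_filter]
  refine (mul_eq_zero.1 ?_).resolve_right (by norm_num : ((5 : ℕ) : ℂ) ≠ 0)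
  rw [Finset.sum_mul]
  refine Eq.trans ?_ hsum
  refine Finset.sum_congr rfl fun m _ => ?_
  rw [hζ.sum_range_pow_mul]
  have : 5 ∣ m.1 + 2 * m.2 + 4 * c ↔ (m.1 + 2 * m.2) % 5 = c := by omega
  simp [this]

/-- Fraction-free Gaussian elimination modulo `p`: reports whether the columns of the matrix with
the given rows are independent. Rows with vanishing leading entry are moved to the end; the first
argument bounds the number of steps. -/
def columnsIndependent (p : ℕ) : ℕ → List (List ℕ) → Bool
  | _, [] => true
  | 0, _ => false
  | _ + 1, [] :: _ => false
  | n + 1, (h :: t) :: rows =>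
    if h % p = 0 then columnsIndependent p n (rows ++ [h :: t])
    else columnsIndependent p n (rows.map fun r =>
      List.zipWith (fun x y => (h * y + (p - r.headD 0 % p) * x) % p) t r.tail)

/-- The product of a row of natural numbers and a column over `ZMod p`. -/
def rowMul {p : ℕ} (r : List ℕ) (v : List (ZMod p)) : ZMod p :=
  (List.zipWith (fun (x : ℕ) (y : ZMod p) => (x : ZMod p) * y) r v).sum

lemma rowMul_combination {p : ℕ} (h c : ℕ) (t r : List ℕ) (v : List (ZMod p))
    (ht : t.length = v.length) (hr : r.length = v.length) :
    rowMul (List.zipWith (fun x y => (h * y + c * x) % p) t r) v =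
      h * rowMul r v + c * rowMul t v := by
  induction v generalizing t r with
  | nil => simp [rowMul]
  | cons z v ih =>
    obtain ⟨x, t, rfl⟩ := List.exists_cons_of_length_eq_add_one ht
    obtain ⟨y, r, rfl⟩ := List.exists_cons_of_length_eq_add_one hr
    have := ih t r (by simpa using ht) (by simpa using hr)
    simp only [rowMul, List.zipWith_cons_cons, List.sum_cons] at this ⊢
    rw [this]
    simp only [ZMod.natCast_mod, Nat.cast_add, Nat.cast_mul]
    ring

lemma eq_zero_of_columnsIndependent {p : ℕ} [Fact p.Prime] (n : ℕ) (rows : List (List ℕ))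
    (v : List (ZMod p)) (hlen : v.length = rows.length) (hrow : ∀ r ∈ rows, r.length = v.length)
    (hv : ∀ r ∈ rows, rowMul r v = 0) (h : columnsIndependent p n rows = true) :
    ∀ z ∈ v, z = 0 := by
  induction n generalizing rows v with
  | zero =>
    cases rows with
    | nil => simp [List.length_eq_zero_iff.1 hlen]
    | cons r rows => simp [columnsIndependent] at h
  | succ n ih =>
    match rows with
    | [] => simp [List.length_eq_zero_iff.1 hlen]
    | [] :: rows => simp [columnsIndependent] at h
    | (a :: t) :: rows =>
      obtain ⟨z, v, rfl⟩ := List.exists_cons_of_length_eq_add_one hlen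
      rw [columnsIndependent] at h
      split_ifs at h with ha
      · refine ih _ (z :: v) ?_ ?_ ?_ h
        · simpa using hlen
        · intro r hr
          exact hrow r (by simpa [or_comm] using hr)
        · intro r hr
          exact hv r (by simpa [or_comm] using hr)
      · have ht : t.length = v.length := by simpa using hrow _ List.mem_cons_self
        have hpiv : (a : ZMod p) * z + rowMul t v = 0 := hv _ List.mem_cons_self
        have htail : ∀ y ∈ v, y = 0 := by
          refine ih _ v (by simpa using hlen) ?_ ?_ h
          · intro r hr
            obtain ⟨r, hr', rfl⟩ := List.mem_map.1 hr
            simp [ht, hrow r (List.mem_cons_of_mem _ hr')]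
          · intro r hr
            obtain ⟨r, hr', rfl⟩ := List.mem_map.1 hr
            have hl := hrow r (List.mem_cons_of_mem _ hr')
            have hz := hv r (List.mem_cons_of_mem _ hr')
            obtain ⟨b, r, rfl⟩ := List.exists_cons_of_length_eq_add_one hl
            have hz' : (b : ZMod p) * z + rowMul r v = 0 := hz
            have hb : ((p - b % p : ℕ) : ZMod p) = -b := by
              rw [Nat.cast_sub (Nat.mod_lt _ (Fact.out : p.Prime).pos).le]
              simp
            rw [List.tail_cons, List.headD_cons, rowMul_combination _ _ _ _ _ ht (by simpa using hl),
              hb]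
            linear_combination (a : ZMod p) * hz' - (b : ZMod p) * hpiv
        have hzero : rowMul t v = 0 := by
          refine List.sum_eq_zero fun w hw => ?_
          obtain ⟨i, hi, rfl⟩ := List.mem_iff_getElem.1 hw
          rw [List.getElem_zipWith, htail _ (List.getElem_mem _), mul_zero]
        have ha' : (a : ZMod p) ≠ 0 := fun h0 =>
          ha (Nat.mod_eq_zero_of_dvd ((ZMod.natCast_eq_zero_iff a p).1 h0))
        rw [hzero, add_zero] at hpiv
        simpa using ⟨(mul_eq_zero.1 hpiv).resolve_left ha', htail⟩

/-- A square system with natural coefficients that is nonsingular modulo `p` has only the trivial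
complex solution. -/
lemma eq_zero_of_columnsIndependent_complex {α β : Type*} (p : ℕ) [Fact p.Prime] (n : ℕ)
    (conds : List β) (vars : List α) (g : β → α → ℕ) (hlen : vars.length = conds.length)
    (h : columnsIndependent p n (conds.map fun b => vars.map (g b)) = true) (a : α → ℂ)
    (ha : ∀ b ∈ conds, (vars.map fun m => (g b m : ℂ) * a m).sum = 0) :
    ∀ m ∈ vars, a m = 0 := by
  let M : Matrix (Fin vars.length) (Fin vars.length) ℤ :=
    Matrix.of fun i j => g (conds[i.1]'(hlen ▸ i.2)) vars[j.1]
  have hdet : (M.map (Int.castRingHom (ZMod p))).det ≠ 0 := by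
    intro h0
    obtain ⟨v, hv, hMv⟩ := Matrix.exists_mulVec_eq_zero_iff.2 h0
    refine hv (funext fun j => ?_)
    refine eq_zero_of_columnsIndependent n _ (List.ofFn v) (by simpa using hlen) ?_ ?_ h _
      (by simp [List.mem_ofFn])
    · simp
    · intro r hr
      obtain ⟨b, hb, rfl⟩ := List.mem_map.1 hr
      obtain ⟨i, hi, rfl⟩ := List.mem_iff_getElem.1 hb
      have := congrFun hMv ⟨i, hlen ▸ hi⟩
      rw [Pi.zero_apply, Matrix.mulVec, dotProduct, ← List.sum_ofFn] at this
      rw [← this, rowMul]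
      congr 1
      apply List.ext_getElem
      · simp
      · intro j h1 h2
        simp [M]
  have hdetC : (M.map (Int.castRingHom ℂ)).det ≠ 0 := by
    rw [← RingHom.mapMatrix_apply, ← RingHom.map_det] at hdet ⊢
    intro h0
    have : M.det = 0 := by simpa using h0
    simp [this] at hdet
  have hzero : (fun j : Fin vars.length => a vars[j.1]) = 0 := by
    refine Matrix.eq_zero_of_mulVec_eq_zero hdetC (funext fun i => ?_)
    rw [Pi.zero_apply, ← ha (conds[i.1]'(hlen ▸ i.2)) (List.getElem_mem _), Matrix.mulVec,
      dotProduct, ← List.sum_ofFn]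
    congr 1
    apply List.ext_getElem
    · simp
    · intro j h1 h2
      simp [M]
  intro m hm
  obtain ⟨j, hj, rfl⟩ := List.mem_iff_getElem.1 hm
  exact congrFun hzero ⟨j, hj⟩

/-- The monomials of degree between `2` and `16` in the isotypic component of weight `c`. -/
def isotypicExponents (c : ℕ) : List (ℕ × ℕ) :=
  (List.range 17 ×ˢ List.range 17).filter fun m =>
    2 ≤ m.1 + m.2 ∧ m.1 + m.2 ≤ 16 ∧ (m.1 + 2 * m.2) % 5 = c

lemma mem_isotypicExponents {c : ℕ} {m : ℕ × ℕ} : m ∈ isotypicExponents c ↔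
    2 ≤ m.1 + m.2 ∧ m.1 + m.2 ≤ 16 ∧ (m.1 + 2 * m.2) % 5 = c := by
  obtain ⟨i, j⟩ := m
  simp only [isotypicExponents, List.mem_filter, List.mem_product, List.mem_range,
    decide_eq_true_eq]
  omega

/-- The conditions for order of vanishing `5` at the points `(1, 1)` and `(1, 2)`. -/
def conditions : List (ℕ × ℕ × ℕ) :=
  ([1, 2] ×ˢ (List.range 5 ×ˢ List.range 5)).filter fun b => b.2.1 + b.2.2 < 5

lemma columnsIndependent_conditions : ∀ c < 5,
    (isotypicExponents c).length = conditions.length ∧ columnsIndependent 10007 1000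
      (conditions.map fun b => (isotypicExponents c).map (condCoeff b)) = true := by
  decide +kernel

theorem L16_2_5p10_empty :
    ∃ (p : ℂ × ℂ) (q : Fin 10 → ℂ × ℂ),
      ∀ f : MvPolynomial (Fin 2) ℂ, f.totalDegree ≤ 16 →
        f ∈ ptIdeal p ^ 2 → (∀ i, f ∈ ptIdeal (q i) ^ 5) → f = 0 := by
  obtain ⟨ζ, hζ⟩ : ∃ ζ : ℂ, IsPrimitiveRoot ζ 5 := ⟨_, Complex.isPrimitiveRoot_exp 5 (by norm_num)⟩
  refine ⟨(0, 0), fun i => (ζ ^ (i.1 % 5), (i.1 / 5 + 1 : ℕ) * ζ ^ (2 * (i.1 % 5))),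
    fun f hdeg hp hq => ?_⟩
  have hlow : ∀ m : ℕ × ℕ, m.1 + m.2 < 2 → coeff (expVec m) f = 0 := by
    intro m hm
    have hid : translateBy (0, 0) f = f := by
      have : translateBy (0, 0) = AlgHom.id ℂ _ := by
        ext i
        fin_cases i <;> simp [translateBy]
      simp [this]
    simpa [hid] using coeff_translateBy_eq_zero hp (k := m.1) (l := m.2) hm
  have hcoeff : ∀ m ∈ exponents 16, coeff (expVec m) f = 0 := by
    intro m hm
    rcases lt_or_ge (m.1 + m.2) 2 with hm2 | hm2
    · exact hlow m hm2
    set c := (m.1 + 2 * m.2) % 5 with hcm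
    have hc : c < 5 := Nat.mod_lt _ (by norm_num)
    obtain ⟨hlen, hind⟩ := columnsIndependent_conditions c hc
    have : Fact (Nat.Prime 10007) := ⟨by norm_num⟩
    rw [mem_exponents] at hm
    refine eq_zero_of_columnsIndependent_complex 10007 1000 conditions (isotypicExponents c)
      condCoeff hlen hind (fun m => coeff (expVec m) f) ?_ m ?_
    · rintro ⟨t, k, l⟩ hb
      simp only [conditions, List.mem_filter, List.mem_product, List.mem_range, List.mem_cons,
        List.not_mem_nil, or_false, decide_eq_true_eq] at hb
      obtain ⟨⟨ht, -, -⟩, hkl⟩ := hb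
      have hsum := sum_isotypic_eq_zero hζ (exponents 16) (fun m => coeff (expVec m) f) t k l
        (fun s hs => by
          have hmem := hq ⟨5 * (t - 1) + s, by omega⟩
          have h1 : (5 * (t - 1) + s) % 5 = s := by omega
          have h2 : (5 * (t - 1) + s) / 5 + 1 = t := by omega
          simp only [h1, h2] at hmem
          have := coeff_translateBy_eq_zero hmem hkl
          rwa [coeff_translateBy hdeg] at this) hc
      have hnodup : (isotypicExponents c).Nodup :=
        (List.nodup_range.product List.nodup_range).filter _
      rw [← List.sum_toFinset _ hnodup, ← hsum]
      refine Finset.sum_subset ?_ ?_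
      · intro m' hm'
        rw [List.mem_toFinset, mem_isotypicExponents] at hm'
        rw [Finset.mem_filter, mem_exponents]
        exact hm'.2
      · intro m' hm' hnot
        rw [Finset.mem_filter, mem_exponents] at hm'
        rw [List.mem_toFinset, mem_isotypicExponents] at hnot
        rw [hlow m' (by omega), mul_zero]
    · exact mem_isotypicExponents.2 ⟨hm2, hm, hcm.symm⟩
  rw [eq_sum_exponents hdeg]
  exact Finset.sum_eq_zero fun m hm => by rw [hcoeff m hm, map_zero]
end

section
/- There exist points p, q, r_1, …, r_8 ∈ ℂ² such that the only polynomial f ∈ ℂ[x,y] of total degree at most 15 that vanishes to order at least 3 at p, to order at least 4 at q, and to order at least 5 at each r_i is the zero polynomial. (The linear system L_15(3, 4, 5^8) is empty and non-special; note C(17,2) = C(4,2) + C(5,2) + 8·C(6,2) = 136.) -/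
open MvPolynomial

/-- The translation automorphism `f(x, y) ↦ f(x + p₁, y + p₂)` of `ℂ[x,y]`. -/
noncomputable def translateAlgEquiv (p : ℂ × ℂ) :
    MvPolynomial (Fin 2) ℂ ≃ₐ[ℂ] MvPolynomial (Fin 2) ℂ :=
  AlgEquiv.ofAlgHom (aeval ![X 0 + C p.1, X 1 + C p.2]) (aeval ![X 0 - C p.1, X 1 - C p.2])
    (by ext i : 1; fin_cases i <;> simp [algebraMap_eq])
    (by ext i : 1; fin_cases i <;> simp [algebraMap_eq])

theorem map_translate_ptIdeal (p : ℂ × ℂ) :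
    (ptIdeal p).map (translateAlgEquiv p) = idealOfVars (Fin 2) ℂ := by
  rw [ptIdeal, Ideal.map_span, idealOfVars]
  congr 1
  ext f
  simp [Set.image_pair, translateAlgEquiv, algebraMap_eq, eq_comm, Fin.exists_fin_two]

/-- Order of vanishing at `p` is the order of the Taylor expansion at `p`. -/
theorem mem_ptIdeal_pow_iff {p : ℂ × ℂ} {m : ℕ} {f : MvPolynomial (Fin 2) ℂ} :
    f ∈ ptIdeal p ^ m ↔ (m : ℕ∞) ≤ (translateAlgEquiv p f : MvPowerSeries (Fin 2) ℂ).order := by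
  have h : f ∈ ptIdeal p ^ m ↔ translateAlgEquiv p f ∈ idealOfVars (Fin 2) ℂ ^ m := by
    rw [← map_translate_ptIdeal, ← Ideal.map_pow]
    exact (Ideal.mem_map_of_equiv (translateAlgEquiv p) _).trans (by simp) |>.symm
  rw [h, mem_pow_idealOfVars_iff']
  refine ⟨fun h => MvPowerSeries.nat_le_order fun d hd => ?_, fun h d hd => ?_⟩
  · simpa using h d hd
  · rw [← coeff_coe]
    exact MvPowerSeries.coeff_of_lt_order (lt_of_lt_of_le (by exact_mod_cast hd) h)

/-- Removing a factor of multiplicity at most `k` lowers the order of vanishing by at most `k`. -/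
theorem mem_ptIdeal_pow_of_mul_mem {p : ℂ × ℂ} {k m : ℕ} {F g : MvPolynomial (Fin 2) ℂ}
    (hF : F ∉ ptIdeal p ^ (k + 1)) (hFg : F * g ∈ ptIdeal p ^ m) :
    g ∈ ptIdeal p ^ (m - k) := by
  rw [mem_ptIdeal_pow_iff] at *
  rw [map_mul, coe_mul, MvPowerSeries.order_mul] at hFg
  have hF' : (translateAlgEquiv p F : MvPowerSeries (Fin 2) ℂ).order ≤ k := by
    rw [not_le] at hF
    exact Order.le_of_lt_add_one (by exact_mod_cast hF)
  rw [ENat.natCast_sub, tsub_le_iff_left]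
  exact hFg.trans (by gcongr)

/-- If a curve `t ↦ (u t, v t)` agrees with `p` modulo `h`, the pull-back of a polynomial vanishing
to order `m` at `p` is divisible by `h ^ m`. -/
theorem pow_dvd_aeval_of_mem_ptIdeal_pow {p : ℂ × ℂ} {m : ℕ} {f : MvPolynomial (Fin 2) ℂ}
    {u v h : Polynomial ℂ} (hu : h ∣ u - Polynomial.C p.1) (hv : h ∣ v - Polynomial.C p.2)
    (hf : f ∈ ptIdeal p ^ m) : h ^ m ∣ aeval ![u, v] f := by
  rw [← Ideal.mem_span_singleton, ← Ideal.span_singleton_pow]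
  have hle : (ptIdeal p).map (aeval ![u, v]) ≤ Ideal.span {h} := by
    rw [ptIdeal, Ideal.map_span, Ideal.span_le]
    rintro _ ⟨_, rfl | rfl, rfl⟩ <;>
      simpa [Ideal.mem_span_singleton, Polynomial.C_eq_algebraMap]
  refine Ideal.pow_right_mono hle m ?_
  rw [← Ideal.map_pow]
  exact Ideal.mem_map_of_mem _ hf

theorem notMem_ptIdeal_pow_one {p : ℂ × ℂ} {F : MvPolynomial (Fin 2) ℂ}
    (hF : eval ![p.1, p.2] F ≠ 0) : F ∉ ptIdeal p ^ (0 + 1) := by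
  intro h
  have hle : ptIdeal p ≤ RingHom.ker (eval ![p.1, p.2]) := by
    rw [ptIdeal, Ideal.span_le]
    rintro _ (rfl | rfl) <;> simp
  exact hF (hle (by simpa using h))

/-- Bézout for a parametrized curve `t ↦ (u t, v t)` of degree at most `e`: too many zeros on the
curve force vanishing along it. -/
theorem aeval_eq_zero_of_mul_totalDegree_lt {ι : Type*} {P : ι → ℂ × ℂ} {m k : ι → ℕ} {a : ι → ℂ}
    {s : Finset ι} {u v : Polynomial ℂ} {e : ℕ} {f : MvPolynomial (Fin 2) ℂ}
    (hu : u.natDegree ≤ e) (hv : v.natDegree ≤ e) (ha : Set.InjOn a s)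
    (hua : ∀ i ∈ s, (Polynomial.X - Polynomial.C (a i)) ^ k i ∣ u - Polynomial.C (P i).1)
    (hva : ∀ i ∈ s, (Polynomial.X - Polynomial.C (a i)) ^ k i ∣ v - Polynomial.C (P i).2)
    (hf : ∀ i ∈ s, f ∈ ptIdeal (P i) ^ m i)
    (hlt : f.totalDegree * e < ∑ i ∈ s, k i * m i) : aeval ![u, v] f = 0 := by
  by_contra hne
  have hdvd : ∏ i ∈ s, (Polynomial.X - Polynomial.C (a i)) ^ (k i * m i) ∣ aeval ![u, v] f := by
    refine Finset.prod_dvd_of_coprime (fun i hi j hj hij => ?_) fun i hi => ?_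
    · refine IsCoprime.pow (Polynomial.isCoprime_X_sub_C_of_isUnit_sub ?_)
      exact (sub_ne_zero.2 fun h => hij (ha hi hj h)).isUnit
    · rw [pow_mul]
      exact pow_dvd_aeval_of_mem_ptIdeal_pow (hua i hi) (hva i hi) (hf i hi)
  have hle := Polynomial.natDegree_le_of_dvd hdvd hne
  have hdeg : (aeval ![u, v] f).natDegree ≤ f.totalDegree * e :=
    aeval_natDegree_le f le_rfl _ fun i => by fin_cases i <;> simpa
  rw [Polynomial.natDegree_prod_of_monic _ _ fun i _ => (Polynomial.monic_X_sub_C _).pow _] at hle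
  simp only [Polynomial.natDegree_pow, Polynomial.natDegree_X_sub_C, mul_one] at hle
  omega

/-- The complex point with the given integral coordinates. -/
def toComplexPoint (p : ℤ × ℤ) : ℂ × ℂ := (p.1, p.2)

/-- No nonzero polynomial of degree less than `n` vanishes to order at least `m i` at each
integral point `P i`. -/
def IsEmptySystem {ι : Type*} (P : ι → ℤ × ℤ) (n : ℕ) (m : ι → ℕ) : Prop :=
  ∀ f : MvPolynomial (Fin 2) ℂ, f.totalDegree < n →
    (∀ i, f ∈ ptIdeal (toComplexPoint (P i)) ^ m i) → f = 0

theorem isEmptySystem_zero {ι : Type*} (P : ι → ℤ × ℤ) (m : ι → ℕ) : IsEmptySystem P 0 m :=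
  fun _ hf => absurd hf (Nat.not_lt_zero _)

/-- Splitting a curve `F` of degree `e` off a linear system that is forced to contain it. -/
theorem IsEmptySystem.of_dvd {ι : Type*} {P : ι → ℤ × ℤ} {n e : ℕ} {m m' k : ι → ℕ}
    (F : MvPolynomial (Fin 2) ℂ) (h : IsEmptySystem P n m') (hdeg : F.totalDegree = e)
    (hk : ∀ i, F ∉ ptIdeal (toComplexPoint (P i)) ^ (k i + 1)) (hm : ∀ i, m' i ≤ m i - k i)
    (hdvd : ∀ f : MvPolynomial (Fin 2) ℂ, f.totalDegree < n + e →
      (∀ i, f ∈ ptIdeal (toComplexPoint (P i)) ^ m i) → F ∣ f) :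
    IsEmptySystem P (n + e) m := by
  intro f hf hfm
  obtain ⟨g, rfl⟩ := hdvd f hf hfm
  by_contra hne
  rw [totalDegree_mul_of_isDomain (left_ne_zero_of_mul hne) (right_ne_zero_of_mul hne)] at hf
  refine right_ne_zero_of_mul hne (h g (by omega) fun i => ?_)
  exact Ideal.pow_le_pow_right (hm i) (mem_ptIdeal_pow_of_mul_mem (hk i) (hfm i))

/-- Two substitutions that agree modulo `F` give the same value modulo `F`. -/
theorem dvd_sub_aeval {F : MvPolynomial (Fin 2) ℂ} {w : Fin 2 → MvPolynomial (Fin 2) ℂ}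
    (hw : ∀ i, F ∣ X i - w i) (f : MvPolynomial (Fin 2) ℂ) : F ∣ f - aeval w f := by
  have h : (Ideal.Quotient.mkₐ ℂ (Ideal.span {F})).comp (aeval w) =
      Ideal.Quotient.mkₐ ℂ (Ideal.span {F}) := by
    ext i : 1
    simpa [Ideal.Quotient.eq, Ideal.mem_span_singleton, dvd_sub_comm] using hw i
  rw [← Ideal.mem_span_singleton, ← Ideal.Quotient.eq]
  exact (DFunLike.congr_fun h f).symm

/-- A polynomial vanishing on the line through `(x₀, y₀)` with direction `(b, -a)` is divisible
by the equation of the line. -/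
theorem line_dvd_of_aeval_eq_zero {a b x₀ y₀ : ℂ} (hab : a ^ 2 + b ^ 2 ≠ 0)
    {f : MvPolynomial (Fin 2) ℂ}
    (hf : aeval ![Polynomial.C x₀ + Polynomial.C b * Polynomial.X,
      Polynomial.C y₀ - Polynomial.C a * Polynomial.X] f = 0) :
    C a * X 0 + C b * X 1 - C (a * x₀ + b * y₀) ∣ f := by
  set T : MvPolynomial (Fin 2) ℂ :=
    C (a ^ 2 + b ^ 2)⁻¹ * (C b * (X 0 - C x₀) - C a * (X 1 - C y₀))
  have hinv : (C (a ^ 2 + b ^ 2)⁻¹ * (C a ^ 2 + C b ^ 2) : MvPolynomial (Fin 2) ℂ) = 1 := by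
    rw [← map_pow, ← map_pow, ← map_add, ← map_mul, inv_mul_cancel₀ hab, map_one]
  have hw : ∀ i, C a * X 0 + C b * X 1 - C (a * x₀ + b * y₀) ∣
      X i - ![C x₀ + C b * T, C y₀ - C a * T] i := by
    simp only [T, map_add, map_mul]
    intro i
    fin_cases i
    · refine ⟨C (a ^ 2 + b ^ 2)⁻¹ * C a, ?_⟩
      simp
      linear_combination (C x₀ - X 0) * hinv
    · refine ⟨C (a ^ 2 + b ^ 2)⁻¹ * C b, ?_⟩
      simp
      linear_combination (C y₀ - X 1) * hinv
  have hT : (aeval ![C x₀ + C b * T, C y₀ - C a * T] : MvPolynomial (Fin 2) ℂ →ₐ[ℂ] _) =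
      (Polynomial.aeval T).comp (aeval ![Polynomial.C x₀ + Polynomial.C b * Polynomial.X,
        Polynomial.C y₀ - Polynomial.C a * Polynomial.X]) := by
    ext i : 1
    fin_cases i <;> simp [algebraMap_eq]
  simpa [hT, hf] using dvd_sub_aeval hw f

theorem totalDegree_line {a b c : ℂ} (hab : a ^ 2 + b ^ 2 ≠ 0) :
    (C a * X 0 + C b * X 1 - C c : MvPolynomial (Fin 2) ℂ).totalDegree = 1 := by
  refine le_antisymm ?_ ?_
  · refine (totalDegree_sub_C_le _ _).trans ((totalDegree_add _ _).trans (max_le ?_ ?_)) <;>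
      exact (totalDegree_mul _ _).trans (by simp)
  · rw [Nat.one_le_iff_ne_zero, Ne, totalDegree_eq_zero_iff_eq_C]
    intro h
    apply hab
    have h₀ := congrArg (pderiv 0) h
    have h₁ := congrArg (pderiv 1) h
    simp [pderiv_X] at h₀ h₁
    simp [h₀, h₁]

theorem line_notMem_ptIdeal_pow_two {a b c : ℂ} (hab : a ^ 2 + b ^ 2 ≠ 0) (p : ℂ × ℂ) :
    (C a * X 0 + C b * X 1 - C c : MvPolynomial (Fin 2) ℂ) ∉ ptIdeal p ^ (1 + 1) := by
  intro hmem
  have hdvd := pow_dvd_aeval_of_mem_ptIdeal_pow (h := Polynomial.X)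
    (u := Polynomial.C p.1 + Polynomial.C a * Polynomial.X)
    (v := Polynomial.C p.2 + Polynomial.C b * Polynomial.X) (by simp) (by simp) hmem
  rw [Polynomial.X_pow_dvd_iff] at hdvd
  have h₁ := hdvd 1 (by norm_num)
  simp [Polynomial.coeff_C] at h₁
  apply hab
  linear_combination h₁

/-- Bézout for the line `a x + b y = c`. -/
theorem line_dvd_of_totalDegree_lt {ι : Type*} {P : ι → ℂ × ℂ} {m : ι → ℕ} {s : Finset ι}
    {a b c : ℂ} {f : MvPolynomial (Fin 2) ℂ} (hP : Function.Injective P)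
    (hab : a ^ 2 + b ^ 2 ≠ 0) (hs : ∀ i ∈ s, a * (P i).1 + b * (P i).2 = c)
    (hf : ∀ i ∈ s, f ∈ ptIdeal (P i) ^ m i) (hlt : f.totalDegree < ∑ i ∈ s, m i) :
    C a * X 0 + C b * X 1 - C c ∣ f := by
  obtain ⟨o, ho⟩ := Finset.nonempty_of_sum_ne_zero (Nat.ne_zero_of_lt hlt)
  rw [← hs o ho]
  refine line_dvd_of_aeval_eq_zero hab ?_
  let t (i : ι) : ℂ := (b * ((P i).1 - (P o).1) - a * ((P i).2 - (P o).2)) / (a ^ 2 + b ^ 2)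
  have ht₁ : ∀ i ∈ s, (P i).1 = (P o).1 + b * t i := by
    intro i hi
    simp only [t]
    field_simp
    linear_combination a * (hs i hi - hs o ho)
  have ht₂ : ∀ i ∈ s, (P i).2 = (P o).2 - a * t i := by
    intro i hi
    simp only [t]
    field_simp
    linear_combination b * (hs i hi - hs o ho)
  refine aeval_eq_zero_of_mul_totalDegree_lt (e := 1) (k := fun _ => 1) (a := t) (s := s)
    (by compute_degree) (by compute_degree) ?_ ?_ ?_ hf (by simpa using hlt)
  · intro i hi j hj hij
    refine hP (Prod.ext ?_ ?_)
    · rw [ht₁ i hi, ht₁ j hj, hij]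
    · rw [ht₂ i hi, ht₂ j hj, hij]
  · intro i hi
    refine ⟨Polynomial.C b, ?_⟩
    rw [ht₁ i hi, map_add, map_mul, pow_one]
    ring
  · intro i hi
    refine ⟨-Polynomial.C a, ?_⟩
    rw [ht₂ i hi, map_sub, map_mul, pow_one]
    ring

theorem toComplexPoint_injective : Function.Injective toComplexPoint := by
  rintro ⟨x, y⟩ ⟨x', y'⟩ h
  simpa [toComplexPoint] using h

/-- Splitting off the line `a x + b y = c` when it meets the system in more points than the degree
allows. -/
theorem IsEmptySystem.of_line {ι : Type*} [Fintype ι] {P : ι → ℤ × ℤ} {n : ℕ} {m m' : ι → ℕ}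
    (hP : Function.Injective P) (a b c : ℤ) (hab : a ^ 2 + b ^ 2 ≠ 0)
    (hsum : n < ∑ i with a * (P i).1 + b * (P i).2 = c, m i)
    (hm : ∀ i, m' i ≤ m i - if a * (P i).1 + b * (P i).2 = c then 1 else 0)
    (h : IsEmptySystem P n m') : IsEmptySystem P (n + 1) m := by
  have hab' : (a : ℂ) ^ 2 + (b : ℂ) ^ 2 ≠ 0 := by exact_mod_cast hab
  refine .of_dvd (C (a : ℂ) * X 0 + C (b : ℂ) * X 1 - C (c : ℂ)) h
    (totalDegree_line hab') (fun i => ?_) hm fun f hf hfm => ?_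
  · split_ifs with hi
    · exact line_notMem_ptIdeal_pow_two hab' _
    · refine notMem_ptIdeal_pow_one ?_
      simpa [toComplexPoint, sub_ne_zero] using mod_cast hi
  · refine line_dvd_of_totalDegree_lt (s := {i | a * (P i).1 + b * (P i).2 = c})
      (toComplexPoint_injective.comp hP) hab' (fun i hi => ?_) (fun i _ => hfm i) (by omega)
    rw [Finset.mem_filter_univ] at hi
    simpa [toComplexPoint] using mod_cast hi

/-- Modulo `y² - x³` every polynomial is of the form `h₀(x) + y h₁(x)`. -/
theorem exists_cuspidalCubic_dvd_sub (f : MvPolynomial (Fin 2) ℂ) :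
    ∃ h₀ h₁ : Polynomial ℂ, (X 1 ^ 2 - X 0 ^ 3 : MvPolynomial (Fin 2) ℂ) ∣
      f - (Polynomial.aeval (X 0) h₀ + X 1 * Polynomial.aeval (X 0) h₁) := by
  induction f using MvPolynomial.induction_on with
  | C a => exact ⟨Polynomial.C a, 0, by simp [algebraMap_eq]⟩
  | add f g hf hg =>
    obtain ⟨h₀, h₁, hf⟩ := hf
    obtain ⟨k₀, k₁, hg⟩ := hg
    refine ⟨h₀ + k₀, h₁ + k₁, ?_⟩
    convert dvd_add hf hg using 1
    simp only [map_add]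
    ring
  | mul_X f i hf =>
    obtain ⟨h₀, h₁, g, hf⟩ := hf
    fin_cases i
    · refine ⟨Polynomial.X * h₀, Polynomial.X * h₁, g * X 0, ?_⟩
      simp only [map_mul, Polynomial.aeval_X, Fin.zero_eta]
      linear_combination X 0 * hf
    · refine ⟨Polynomial.X ^ 3 * h₁, h₀, g * X 1 + Polynomial.aeval (X 0) h₁, ?_⟩
      simp only [map_mul, map_pow, Polynomial.aeval_X, Fin.mk_one]
      linear_combination X 1 * hf

/-- A polynomial vanishing on the cuspidal cubic `t ↦ (t², t³)` is divisible by its equation. -/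
theorem cuspidalCubic_dvd_of_aeval_eq_zero {f : MvPolynomial (Fin 2) ℂ}
    (hf : aeval ![(Polynomial.X : Polynomial ℂ) ^ 2, Polynomial.X ^ 3] f = 0) :
    X 1 ^ 2 - X 0 ^ 3 ∣ f := by
  obtain ⟨h₀, h₁, hdvd⟩ := exists_cuspidalCubic_dvd_sub f
  obtain ⟨g, hg⟩ := hdvd
  have hzero : Polynomial.expand ℂ 2 h₀ + Polynomial.X ^ 3 * Polynomial.expand ℂ 2 h₁ = 0 := by
    have := congrArg (aeval ![(Polynomial.X : Polynomial ℂ) ^ 2, Polynomial.X ^ 3]) hg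
    simp only [map_sub, map_add, map_mul, map_pow, hf, ← Polynomial.aeval_algHom_apply, aeval_X,
      Matrix.cons_val_zero, Matrix.cons_val_one] at this
    rw [Polynomial.expand_eq_comp_X_pow, Polynomial.expand_eq_comp_X_pow,
      Polynomial.comp_eq_aeval, Polynomial.comp_eq_aeval]
    linear_combination -this
  have h₀_zero : h₀ = 0 := by
    ext n
    have := congrArg (Polynomial.coeff · (n * 2)) hzero
    have hodd : 3 ≤ n * 2 → ¬ 2 ∣ n * 2 - 3 := by omega
    simpa +contextual [Polynomial.coeff_X_pow_mul', Polynomial.coeff_expand, hodd] using this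
  have h₁_zero : h₁ = 0 := by
    ext n
    have := congrArg (Polynomial.coeff · (n * 2 + 3)) hzero
    simpa [h₀_zero] using this
  exact ⟨g, by simpa [h₀_zero, h₁_zero] using hg⟩

theorem totalDegree_cuspidalCubic :
    (X 1 ^ 2 - X 0 ^ 3 : MvPolynomial (Fin 2) ℂ).totalDegree = 3 := by
  rw [sub_eq_add_neg, totalDegree_add_eq_right_of_totalDegree_lt] <;> simp [totalDegree_neg]

theorem cuspidalCubic_notMem_ptIdeal_pow (t : ℂ) :
    (X 1 ^ 2 - X 0 ^ 3 : MvPolynomial (Fin 2) ℂ) ∉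
      ptIdeal (t ^ 2, t ^ 3) ^ ((if t = 0 then 2 else 1) + 1) := by
  intro hmem
  have hdvd := pow_dvd_aeval_of_mem_ptIdeal_pow (h := Polynomial.X)
    (u := Polynomial.C (t ^ 2)) (v := Polynomial.C (t ^ 3) + Polynomial.X)
    (by simp) (by simp) hmem
  have heq : aeval ![Polynomial.C (t ^ 2), Polynomial.C (t ^ 3) + Polynomial.X]
      (X 1 ^ 2 - X 0 ^ 3 : MvPolynomial (Fin 2) ℂ) =
      Polynomial.C (2 * t ^ 3) * Polynomial.X + Polynomial.X ^ 2 := by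
    simp only [map_sub, map_pow, aeval_X, Matrix.cons_val_zero, Matrix.cons_val_one, map_mul,
      map_ofNat]
    ring
  rw [heq, Polynomial.X_pow_dvd_iff] at hdvd
  split_ifs at hdvd with ht
  · simpa [ht] using hdvd 2 (by norm_num)
  · simpa [Polynomial.coeff_X_pow, ht, -map_pow, -map_mul] using hdvd 1 (by norm_num)

/-- Splitting off the cuspidal cubic `y² = x³` when it meets the system in more points than the
degree allows. The points on the cubic have parameters `t i`. -/
theorem IsEmptySystem.of_cuspidalCubic {ι : Type*} [Fintype ι] {P : ι → ℤ × ℤ} {n : ℕ}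
    {m m' k : ι → ℕ} (hP : Function.Injective P) (t : ι → ℤ)
    (ht : ∀ i, (P i).2 ^ 2 = (P i).1 ^ 3 → P i = (t i ^ 2, t i ^ 3))
    (hk : ∀ i, k i = if (P i).2 ^ 2 = (P i).1 ^ 3 then if t i = 0 then 2 else 1 else 0)
    (hsum : (n + 2) * 3 < ∑ i, k i * m i) (hm : ∀ i, m' i ≤ m i - k i)
    (h : IsEmptySystem P n m') : IsEmptySystem P (n + 3) m := by
  have hpt : ∀ i, (P i).2 ^ 2 = (P i).1 ^ 3 →
      toComplexPoint (P i) = ((t i : ℂ) ^ 2, (t i : ℂ) ^ 3) := by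
    intro i hi
    rw [ht i hi]
    simp [toComplexPoint]
  refine .of_dvd (X 1 ^ 2 - X 0 ^ 3) h totalDegree_cuspidalCubic (fun i => ?_) hm
    fun f hf hfm => cuspidalCubic_dvd_of_aeval_eq_zero ?_
  · rw [hk]
    by_cases hi : (P i).2 ^ 2 = (P i).1 ^ 3
    · rw [if_pos hi, hpt i hi]
      simpa using cuspidalCubic_notMem_ptIdeal_pow (t i)
    · rw [if_neg hi]
      refine notMem_ptIdeal_pow_one ?_
      simpa [toComplexPoint, sub_ne_zero] using mod_cast hi
  · refine aeval_eq_zero_of_mul_totalDegree_lt (e := 3) (k := k) (m := m)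
      (a := fun i => (t i : ℂ)) (s := {i | (P i).2 ^ 2 = (P i).1 ^ 3})
      (P := fun i => toComplexPoint (P i)) (by simp) (by simp) ?_ ?_ ?_ (fun i _ => hfm i) ?_
    · intro i hi j hj hij
      simp only [Finset.coe_filter, Finset.mem_univ, true_and, Set.mem_ofPred_eq] at hi hj
      exact hP (toComplexPoint_injective (by rw [hpt i hi, hpt j hj, show (t i : ℂ) = t j from hij]))
    · intro i hi
      rw [Finset.mem_filter_univ] at hi
      rw [hk, if_pos hi, hpt i hi]
      split_ifs with h0
      · simp [h0]
      · simpa using sub_dvd_pow_sub_pow Polynomial.X (Polynomial.C (t i : ℂ)) 2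
    · intro i hi
      rw [Finset.mem_filter_univ] at hi
      rw [hk, if_pos hi, hpt i hi]
      split_ifs with h0
      · simpa [h0] using pow_dvd_pow (Polynomial.X : Polynomial ℂ) (show 2 ≤ 3 by norm_num)
      · simpa using sub_dvd_pow_sub_pow Polynomial.X (Polynomial.C (t i : ℂ)) 3
    · refine lt_of_le_of_lt (by omega) (hsum.trans_le (Finset.sum_subset (Finset.subset_univ _)
        fun i _ hi => ?_).ge)
      rw [Finset.mem_filter_univ] at hi
      rw [hk, if_neg hi, zero_mul]

/-- Nine points `(t², t³)` of the cuspidal cubic, the cusp among them, and a tenth point, chosen so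
that many of the lines joining them contain three of them. -/
def specialPoints : Fin 10 → ℤ × ℤ :=
  ![(4, -8), (0, 0), (4, 8), (9, 27), (144, -1728), (36, 216), (144, 1728), (9, -27),
    (16, -64), (144, -972)]

/-- Splitting off the cuspidal cubic and lines reduces the system to degree below zero. -/
theorem isEmptySystem_specialPoints :
    IsEmptySystem specialPoints 16 ![3, 4, 5, 5, 5, 5, 5, 5, 5, 5] := by
  have hP : Function.Injective specialPoints := by decide
  refine .of_cuspidalCubic (m' := ![2, 2, 4, 4, 4, 4, 4, 4, 4, 5]) hP
    ![-2, 0, 2, 3, -12, 6, 12, -3, -4, 0] (k := ![1, 2, 1, 1, 1, 1, 1, 1, 1, 0])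
    (by decide) (by decide) (by decide) (by decide) ?_
  refine .of_line (m' := ![2, 2, 3, 4, 4, 4, 4, 3, 4, 4]) hP 7 1 36 (by decide)
    (by decide) (by decide) ?_
  refine .of_line (m' := ![2, 2, 3, 4, 4, 3, 3, 3, 3, 4]) hP (-14) 1 (-288) (by decide)
    (by decide) (by decide) ?_
  refine .of_line (m' := ![2, 2, 3, 3, 3, 3, 3, 3, 2, 4]) hP 13 1 144 (by decide)
    (by decide) (by decide) ?_
  refine .of_line (m' := ![2, 2, 2, 3, 3, 3, 3, 2, 2, 3]) hP 7 1 36 (by decide)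
    (by decide) (by decide) ?_
  refine .of_line (m' := ![2, 2, 2, 3, 2, 3, 2, 2, 2, 2]) hP 1 0 144 (by decide)
    (by decide) (by decide) ?_
  refine .of_line (m' := ![1, 2, 2, 2, 2, 2, 2, 2, 2, 2]) hP (-7) 1 (-36) (by decide)
    (by decide) (by decide) ?_
  refine .of_cuspidalCubic (m' := ![0, 0, 1, 1, 1, 1, 1, 1, 1, 2]) hP
    ![-2, 0, 2, 3, -12, 6, 12, -3, -4, 0] (k := ![1, 2, 1, 1, 1, 1, 1, 1, 1, 0])
    (by decide) (by decide) (by decide) (by decide) ?_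
  refine .of_line (m' := ![0, 0, 0, 1, 1, 1, 1, 0, 1, 1]) hP 7 1 36 (by decide)
    (by decide) (by decide) ?_
  refine .of_line (m' := ![0, 0, 0, 1, 1, 0, 0, 0, 0, 1]) hP (-14) 1 (-288) (by decide)
    (by decide) (by decide) ?_
  refine .of_line (m' := ![0, 0, 0, 0, 1, 0, 0, 0, 0, 0]) hP 37 5 468 (by decide)
    (by decide) (by decide) ?_
  refine .of_line (m' := ![0, 0, 0, 0, 0, 0, 0, 0, 0, 0]) hP 1 0 144 (by decide)
    (by decide) (by decide) ?_
  exact isEmptySystem_zero _ _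

theorem L15_3_4_5p8_empty :
    ∃ (p : ℂ × ℂ) (q : ℂ × ℂ) (r : Fin 8 → ℂ × ℂ),
      ∀ f : MvPolynomial (Fin 2) ℂ, f.totalDegree ≤ 15 →
        f ∈ ptIdeal p ^ 3 → f ∈ ptIdeal q ^ 4 → (∀ i, f ∈ ptIdeal (r i) ^ 5) → f = 0 := by
  refine ⟨toComplexPoint (specialPoints 0), toComplexPoint (specialPoints 1),
    fun i => toComplexPoint (specialPoints i.succ.succ), fun f hf hp hq hr => ?_⟩
  refine isEmptySystem_specialPoints f (Nat.lt_succ_of_le hf) (Fin.cons hp (Fin.cons hq ?_))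
  intro i
  fin_cases i <;> exact hr _
end

section
/- There exist points p, q_1, …, q_10 ∈ ℂ² such that the only polynomial f ∈ ℂ[x,y] of total degree at most 23 that vanishes to order at least 6 at p and to order at least 7 at each q_i is the zero polynomial. (The linear system L_23(6, 7^10) is empty; note the number of imposed conditions C(7,2) + 10·C(8,2) = 301 exceeds C(25,2) = 300.) -/
open MvPolynomial

open Filter Topology

/-- A derivation lowers the order of vanishing along an ideal by at most one. -/
theorem Derivation.map_mem_ideal_pow {R A : Type*} [CommRing R] [CommRing A] [Algebra R A]
    (d : Derivation R A A) (I : Ideal A) (k : ℕ) {f : A} (hf : f ∈ I ^ (k + 1)) :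
    d f ∈ I ^ k := by
  induction k generalizing f with
  | zero => simp
  | succ k ih =>
    rw [pow_succ] at hf
    induction hf using Submodule.mul_induction_on' with
    | mem_mul_mem a ha b hb =>
      rw [d.leibniz, smul_eq_mul, smul_eq_mul]
      refine add_mem (Ideal.mul_mem_right _ _ ha) ?_
      rw [pow_succ']
      exact Ideal.mul_mem_mul hb (ih ha)
    | add a _ b _ ha hb =>
      rw [map_add]
      exact add_mem ha hb

/-- The value at the exponent `α` of the linear form with coefficients `u`. -/
def linForm (u : ℤ × ℤ) (α : ℕ × ℕ) : ℤ := u.1 * α.1 + u.2 * α.2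

/-- The exponent of the monomial `x ^ α.1 * y ^ α.2`. -/
noncomputable def expo (α : ℕ × ℕ) : Fin 2 →₀ ℕ :=
  Finsupp.single 0 α.1 + Finsupp.single 1 α.2

@[simp] theorem expo_zero (α : ℕ × ℕ) : expo α 0 = α.1 := by simp [expo]

@[simp] theorem expo_one (α : ℕ × ℕ) : expo α 1 = α.2 := by simp [expo]

theorem expo_eq (s : Fin 2 →₀ ℕ) : expo (s 0, s 1) = s := by
  ext i
  fin_cases i <;> simp

theorem expo_injective : Function.Injective expo := fun α β h =>
  Prod.ext (by simpa using DFunLike.congr_fun h 0) (by simpa using DFunLike.congr_fun h 1)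

/-- The Euler operator `u.1 x ∂/∂x + u.2 y ∂/∂y - c`, which multiplies the monomial with
exponent `α` by `linForm u α - c`. -/
noncomputable def eulerOp (l : (ℤ × ℤ) × ℤ) :
    MvPolynomial (Fin 2) ℂ →ₗ[ℂ] MvPolynomial (Fin 2) ℂ :=
  (((l.1.1 : ℂ) • (X 0 : MvPolynomial (Fin 2) ℂ) • pderiv (R := ℂ) (0 : Fin 2) +
    (l.1.2 : ℂ) • (X 1 : MvPolynomial (Fin 2) ℂ) • pderiv (R := ℂ) (1 : Fin 2) :
      Derivation ℂ (MvPolynomial (Fin 2) ℂ) (MvPolynomial (Fin 2) ℂ)) :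
      MvPolynomial (Fin 2) ℂ →ₗ[ℂ] MvPolynomial (Fin 2) ℂ) - (l.2 : ℂ) • LinearMap.id

theorem eulerOp_monomial (l : (ℤ × ℤ) × ℤ) (α : ℕ × ℕ) (c : ℂ) :
    eulerOp l (monomial (expo α) c) =
      monomial (expo α) (((linForm l.1 α - l.2 : ℤ) : ℂ) * c) := by
  simp only [eulerOp, LinearMap.sub_apply, Derivation.coeFn_coe, Derivation.add_apply,
    Derivation.smul_apply, smul_eq_mul, X_mul_pderiv_monomial, LinearMap.smul_apply,
    LinearMap.id_apply, expo_zero, expo_one, ← Nat.cast_smul_eq_nsmul ℂ, smul_smul,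
    ← add_smul, ← sub_smul]
  rw [smul_monomial, smul_eq_mul, linForm]
  push_cast
  rfl

theorem eulerOp_mem (l : (ℤ × ℤ) × ℤ) (I : Ideal (MvPolynomial (Fin 2) ℂ)) (k : ℕ)
    {f : MvPolynomial (Fin 2) ℂ} (hf : f ∈ I ^ (k + 1)) : eulerOp l f ∈ I ^ k := by
  refine sub_mem (Derivation.map_mem_ideal_pow _ I k hf) ?_
  rw [LinearMap.smul_apply, LinearMap.id_apply, smul_eq_C_mul]
  exact Ideal.mul_mem_left _ _ (Ideal.pow_le_pow_right k.le_succ hf)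

/-- The product of the affine forms `linForm u - c`, for `(u, c)` in the list. -/
def lineProd (L : List ((ℤ × ℤ) × ℤ)) (α : ℕ × ℕ) : ℤ :=
  (L.map fun l => linForm l.1 α - l.2).prod

/-- The polynomial with exponents in `D` and coefficients `c`. -/
noncomputable def polyOf (D : Finset (ℕ × ℕ)) :
    (D → ℂ) →ₗ[ℂ] MvPolynomial (Fin 2) ℂ :=
  ∑ α : D, monomial (expo α) ∘ₗ LinearMap.proj α

theorem polyOf_apply (D : Finset (ℕ × ℕ)) (c : D → ℂ) :
    polyOf D c = ∑ α : D, monomial (expo α) (c α) := by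
  simp [polyOf]

theorem polyOf_coeff {D : Finset (ℕ × ℕ)} {f : MvPolynomial (Fin 2) ℂ}
    (hf : ∀ s ∈ f.support, (s 0, s 1) ∈ D) :
    polyOf D (fun α => f.coeff (expo α)) = f := by
  rw [polyOf_apply, Finset.sum_coe_sort D fun α => monomial (expo α) (f.coeff (expo α))]
  conv_rhs => rw [f.as_sum]
  symm
  refine Finset.sum_of_injOn (fun s : Fin 2 →₀ ℕ => (s 0, s 1)) ?_ ?_ ?_ ?_
  · intro s _ t _ h
    rw [← expo_eq s, ← expo_eq t]
    exact congrArg expo h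
  · exact fun s hs => hf s hs
  · intro α _ h
    have : f.coeff (expo α) = 0 := by
      by_contra hne
      exact h ⟨expo α, mem_support_iff.2 hne, by simp⟩
    rw [this, map_zero]
  · intro s _
    simp only [expo_eq]

theorem sum_lineProd_eq_zero {D : Finset (ℕ × ℕ)} {p : ℂ × ℂ} (L : List ((ℤ × ℤ) × ℤ))
    {c : D → ℂ} (hc : polyOf D c ∈ ptIdeal p ^ (L.length + 1)) :
    ∑ α : D, c α * (lineProd L α : ℂ) * (p.1 ^ α.1.1 * p.2 ^ α.1.2) = 0 := by
  induction L generalizing c with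
  | nil =>
    have hle : ptIdeal p ≤ RingHom.ker (eval ![p.1, p.2]) := by
      rw [ptIdeal, Ideal.span_le]
      rintro g (rfl | rfl) <;> simp [RingHom.mem_ker]
    have h0 := RingHom.mem_ker.1 (hle (by simpa using hc))
    simpa [polyOf_apply, eval_monomial, lineProd, Finsupp.prod_fintype] using h0
  | cons l L ih =>
    have key : eulerOp l (polyOf D c) =
        polyOf D fun α => ((linForm l.1 α - l.2 : ℤ) : ℂ) * c α := by
      simp only [polyOf_apply, map_sum, eulerOp_monomial]
    have h0 := ih (key ▸ eulerOp_mem l _ _ hc)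
    rw [← h0]
    refine Finset.sum_congr rfl fun α _ => ?_
    simp only [lineProd, List.map_cons, List.prod_cons]
    push_cast
    ring

/-- Degeneration along a one-parameter subgroup: if every coordinate in `B` is the
lowest-weight term of some test functional, then for a suitable parameter `t` the twisted test
functionals cut out no more than the coordinate subspace on which `B` vanishes. -/
theorem exists_twist_eq_zero {ι : Type*} [Fintype ι] (w : ι → ℤ) (B : Set ι)
    (T : Set (ι → ℂ)) (W : Submodule ℂ (ι → ℂ))
    (hT : ∀ β ∈ B, ∃ P ∈ T, P β ≠ 0 ∧ ∀ α, α ≠ β → w α ≤ w β → P α = 0)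
    (hW : ∀ c ∈ W, (∀ β ∈ B, c β = 0) → c = 0) :
    ∃ t : ℂ, t ≠ 0 ∧ ∀ c ∈ W, (∀ P ∈ T, ∑ α, c α * P α * t ^ w α = 0) → c = 0 := by
  classical
  by_contra! hcon
  let t : ℕ → ℂ := fun n => 1 / ((n : ℂ) + 1)
  have ht0 : ∀ n, t n ≠ 0 := fun n => one_div_ne_zero (Nat.cast_add_one_ne_zero n)
  have htlim : Tendsto t atTop (𝓝 0) := tendsto_one_div_add_atTop_nhds_zero_nat
  have hex : ∀ n, ∃ c ∈ W, ‖c‖ = 1 ∧ ∀ P ∈ T, ∑ α, c α * P α * t n ^ w α = 0 := by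
    intro n
    obtain ⟨c, hcW, hcT, hc0⟩ := hcon (t n) (ht0 n)
    refine ⟨((‖c‖ : ℂ)⁻¹) • c, W.smul_mem _ hcW, ?_, fun P hP => ?_⟩
    · rw [norm_smul, norm_inv, Complex.norm_real, norm_norm,
        inv_mul_cancel₀ (norm_ne_zero_iff.2 hc0)]
    · simp only [Pi.smul_apply, smul_eq_mul, mul_assoc, ← Finset.mul_sum]
      simp only [← mul_assoc, hcT P hP, mul_zero]
  choose c hcW hc1 hcT using hex
  obtain ⟨a, ha, φ, hφ, hlim⟩ := (isCompact_sphere (0 : ι → ℂ) 1).tendsto_subseq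
    (x := c) fun n => by simpa using hc1 n
  have haW : a ∈ W := W.closed_of_finiteDimensional.mem_of_tendsto hlim
    (Eventually.of_forall fun n => hcW (φ n))
  have ha0 : a = 0 := by
    refine hW a haW fun β hβ => ?_
    obtain ⟨P, hP, hPβ, hPα⟩ := hT β hβ
    have hcoord : ∀ α, Tendsto (fun n => c (φ n) α) atTop (𝓝 (a α)) :=
      fun α => (continuous_apply α).continuousAt.tendsto.comp hlim
    have hterm : ∀ α, Tendsto (fun n => c (φ n) α * P α * t (φ n) ^ (w α - w β)) atTop
        (𝓝 (if α = β then a β * P β else 0)) := by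
      intro α
      split_ifs with h
      · subst h
        simpa using (hcoord α).mul_const (P α)
      · rcases le_or_gt (w α) (w β) with hle | hlt
        · simp [hPα α h hle]
        · obtain ⟨k, hk⟩ := Int.eq_ofNat_of_zero_le (sub_pos.2 hlt).le
          have hk0 : k ≠ 0 := by omega
          have := ((hcoord α).mul_const (P α)).mul
            ((htlim.comp hφ.tendsto_atTop).pow k)
          simpa [hk, hk0] using this
    have hsum := tendsto_finsetSum Finset.univ fun α _ => hterm α
    have hzero : ∀ n, ∑ α, c (φ n) α * P α * t (φ n) ^ (w α - w β) = 0 := by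
      intro n
      simp only [zpow_sub₀ (ht0 (φ n)), ← mul_div_assoc, ← Finset.sum_div, hcT _ P hP, zero_div]
    simp only [hzero, Finset.sum_ite_eq', Finset.mem_univ, if_true] at hsum
    exact (mul_eq_zero.1 (tendsto_nhds_unique tendsto_const_nhds hsum).symm).resolve_right hPβ
  simp [ha0] at ha

/-- Searches for `k` lines, with directions prescribed by `us`, that avoid `β` and cover the
given points. -/
def coverable (us : List (ℤ × ℤ)) (β : ℕ × ℕ) : ℕ → List (ℕ × ℕ) → Bool
  | _, [] => true
  | 0, _ :: _ => false
  | k + 1, α :: S => us.any fun u =>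
      linForm u α != linForm u β &&
        coverable us β k (S.filter fun γ => linForm u γ != linForm u α)

theorem exists_lines_of_coverable {us : List (ℤ × ℤ)} {β : ℕ × ℕ} {k : ℕ}
    {S : List (ℕ × ℕ)} (h : coverable us β k S) :
    ∃ L : List ((ℤ × ℤ) × ℤ), L.length ≤ k ∧ lineProd L β ≠ 0 ∧
      ∀ α ∈ S, lineProd L α = 0 := by
  induction k generalizing S with
  | zero =>
    cases S with
    | nil => exact ⟨[], by simp [lineProd]⟩
    | cons α S => simp [coverable] at h
  | succ k ih =>
    cases S with
    | nil => exact ⟨[], by simp [lineProd]⟩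
    | cons α S =>
      simp only [coverable, List.any_eq_true, Bool.and_eq_true, bne_iff_ne] at h
      obtain ⟨u, -, hne, hcov⟩ := h
      obtain ⟨L, hlen, hβ, hS⟩ := ih hcov
      refine ⟨(u, linForm u α) :: L, by simpa using hlen, ?_, fun γ hγ => ?_⟩
      · simpa [lineProd, sub_eq_zero, hne.symm] using hβ
      · by_cases hγα : linForm u γ = linForm u α
        · simp [lineProd, hγα]
        · have hγS : γ ∈ S := by
            rcases List.mem_cons.1 hγ with rfl | hmem
            · exact absurd rfl hγα
            · exact hmem
          have := hS γ (by simp [hγS, hγα])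
          simp only [lineProd, List.map_cons, List.prod_cons] at this ⊢
          rw [this, mul_zero]

/-- A move of the checker game: a point of multiplicity `m` is sent to the boundary along the
one-parameter subgroup of weight `w`. It removes checkers of weight at most `bound`, using covers
by lines with directions in `dirs`. -/
structure CheckerMove where
  m : ℕ
  w : ℤ × ℤ
  bound : ℤ
  dirs : List (ℤ × ℤ)

/-- The checker `β` is removed if fewer than `m` lines avoid it and cover all the other checkers
that are at most as heavy. -/
def CheckerMove.removes (M : CheckerMove) (D : List (ℕ × ℕ)) (β : ℕ × ℕ) : Bool :=
  decide (linForm M.w β ≤ M.bound) &&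
    coverable M.dirs β (M.m - 1)
      (D.filter fun α => decide (linForm M.w α ≤ linForm M.w β) && α != β)

/-- The checkers left on the board `D` after a move. -/
def CheckerMove.play (M : CheckerMove) (D : List (ℕ × ℕ)) : List (ℕ × ℕ) :=
  D.filter fun β => !M.removes D β

theorem CheckerMove.exists_point {M : CheckerMove} (hm : M.m ≠ 0) (D : List (ℕ × ℕ))
    (W : Submodule ℂ (MvPolynomial (Fin 2) ℂ))
    (hW : ∀ f ∈ W, (∀ s ∈ f.support, (s 0, s 1) ∈ M.play D) → f = 0) :
    ∃ p : ℂ × ℂ, ∀ f ∈ W, (∀ s ∈ f.support, (s 0, s 1) ∈ D) →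
      f ∈ ptIdeal p ^ M.m → f = 0 := by
  let T : Set (D.toFinset → ℂ) :=
    {P | ∃ L : List ((ℤ × ℤ) × ℤ), L.length + 1 ≤ M.m ∧ P = fun α => (lineProd L α.1 : ℂ)}
  have hT : ∀ β ∈ {β : D.toFinset | M.removes D β}, ∃ P ∈ T, P β ≠ 0 ∧
      ∀ α : D.toFinset, α ≠ β → linForm M.w α ≤ linForm M.w β → P α = 0 := by
    intro β hβ
    simp only [Set.mem_ofPred_eq, CheckerMove.removes, Bool.and_eq_true] at hβ
    obtain ⟨L, hlen, hLβ, hL⟩ := exists_lines_of_coverable hβ.2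
    refine ⟨_, ⟨L, by omega, rfl⟩, by exact_mod_cast hLβ, fun α hne hle => ?_⟩
    have := hL α (by
      have := List.mem_toFinset.1 α.2
      simp [this, hle, Subtype.coe_ne_coe.2 hne])
    exact_mod_cast this
  have hB : ∀ c ∈ W.comap (polyOf D.toFinset),
      (∀ β ∈ {β : D.toFinset | M.removes D β}, c β = 0) → c = 0 := by
    intro c hc hB
    have hsupp : ∀ α : D.toFinset, (polyOf D.toFinset c).coeff (expo α) = c α := by
      intro α
      simp [polyOf_apply, coeff_sum, coeff_monomial, expo_injective.eq_iff]
    have h0 : polyOf D.toFinset c = 0 := by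
      refine hW _ hc fun s hs => ?_
      obtain ⟨α, hα, hne⟩ : ∃ α : D.toFinset, expo α = s ∧ c α ≠ 0 := by
        by_contra! hno
        refine mem_support_iff.1 hs ?_
        simp only [polyOf_apply, coeff_sum, coeff_monomial]
        refine Finset.sum_eq_zero fun α _ => ?_
        split_ifs with hα
        · exact hno α hα
        · rfl
      subst hα
      have hα := List.mem_toFinset.1 α.2
      have : ¬ M.removes D α := fun hr => hne (hB α hr)
      simpa [CheckerMove.play, hα] using this
    funext α
    rw [← hsupp α, h0, coeff_zero, Pi.zero_apply]
  obtain ⟨t, ht, h⟩ := exists_twist_eq_zero _ _ T _ hT hB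
  refine ⟨(t ^ M.w.1, t ^ M.w.2), fun f hfW hfD hf => ?_⟩
  have hpoly := polyOf_coeff (D := D.toFinset) (f := f) (by simpa using hfD)
  rw [← hpoly, h (fun α => f.coeff (expo α)) (by simpa [hpoly] using hfW), map_zero]
  rintro _ ⟨L, hL, rfl⟩
  have := sum_lineProd_eq_zero (D := D.toFinset) (c := fun α => f.coeff (expo α)) L
    (by rw [hpoly]; exact Ideal.pow_le_pow_right hL hf)
  rw [← this]
  refine Finset.sum_congr rfl fun α _ => ?_
  rw [linForm, zpow_add₀ ht, zpow_mul, zpow_mul, zpow_natCast, zpow_natCast]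

/-- Evaluates a list completely before handing it to a continuation. -/
def List.force {α β : Type*} : List α → (List α → β) → β
  | [], k => k []
  | a :: l, k => l.force fun l' => k (a :: l')

theorem List.force_eq {α β : Type*} (l : List α) (k : List α → β) : l.force k = k l := by
  induction l generalizing k with
  | nil => rfl
  | cons a l ih => exact ih _

/-- Whether the given moves clear the board. -/
def winning : List CheckerMove → List (ℕ × ℕ) → Bool
  | [], D => D.isEmpty
  | M :: Ms, D => M.m != 0 && (M.play D).force (winning Ms)

/-- A won game yields a position of the points for which no nonzero polynomial with exponents on
the board has the prescribed multiplicities. -/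
theorem exists_points_of_winning {Ms : List CheckerMove} {D : List (ℕ × ℕ)}
    (h : winning Ms D) :
    ∃ p : Fin Ms.length → ℂ × ℂ, ∀ f : MvPolynomial (Fin 2) ℂ,
      (∀ s ∈ f.support, (s 0, s 1) ∈ D) → (∀ i, f ∈ ptIdeal (p i) ^ (Ms.get i).m) → f = 0 := by
  induction Ms generalizing D with
  | nil =>
    refine ⟨fun _ => 0, fun f hf _ => ?_⟩
    obtain rfl : D = [] := by simpa [winning] using h
    simpa [← support_eq_empty, Finset.eq_empty_iff_forall_notMem] using hf
  | cons M Ms ih =>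
    simp only [winning, List.force_eq, Bool.and_eq_true, bne_iff_ne] at h
    obtain ⟨q, hq⟩ := ih h.2
    obtain ⟨p, hp⟩ := CheckerMove.exists_point h.1 D
      (⨅ i, (ptIdeal (q i) ^ (Ms.get i).m).restrictScalars ℂ)
      (fun f hf hs => hq f hs (by simpa [Submodule.mem_iInf] using hf))
    refine ⟨Fin.cons p q, fun f hs hf => hp f ?_ hs ?_⟩
    · simpa [Submodule.mem_iInf] using fun i => hf (Fin.succ i)
    · simpa using hf 0

/-- The exponents of the monomials of degree less than `n`. -/
def triangle (n : ℕ) : List (ℕ × ℕ) :=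
  (List.range n).flatMap fun i => (List.range (n - i)).map fun j => (i, j)

theorem mem_triangle {n : ℕ} {α : ℕ × ℕ} : α ∈ triangle n ↔ α.1 + α.2 < n := by
  obtain ⟨i, j⟩ := α
  simp [triangle]
  omega

/-- Moves clearing the triangular board of side `24`; the ninth one has multiplicity `6`. -/
def triangleGame : List CheckerMove :=
  [⟨7, (51, 49), 306, [(1, 0), (0, 1)]⟩,
   ⟨7, (51, -49), -527, [(1, 0), (1, -1)]⟩,
   ⟨7, (-50, -1), -850, [(1, 0), (1, 1)]⟩,
   ⟨7, (-51, 49), -510, [(0, 1), (1, 0)]⟩,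
   ⟨7, (49, -51), -510, [(1, 0), (0, 1)]⟩,
   ⟨7, (1, -50), -498, [(0, 1), (1, -1)]⟩,
   ⟨7, (-49, 51), -143, [(1, -1), (0, 1)]⟩,
   ⟨7, (51, 49), 643, [(1, 1), (1, 0)]⟩,
   ⟨6, (-50, -1), -560, [(1, 0), (1, 1)]⟩,
   ⟨7, (51, 49), 796, [(1, 1), (1, 0)]⟩,
   ⟨7, (1, 50), 610, [(1, 1), (0, 1)]⟩]

theorem winning_triangleGame : winning triangleGame (triangle 24) := by
  rw [← List.force_eq (triangle 24) (winning triangleGame)]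
  decide +kernel

theorem L23_6_7p10_empty :
    ∃ (p : ℂ × ℂ) (q : Fin 10 → ℂ × ℂ),
      ∀ f : MvPolynomial (Fin 2) ℂ, f.totalDegree ≤ 23 →
        f ∈ ptIdeal p ^ 6 → (∀ i, f ∈ ptIdeal (q i) ^ 7) → f = 0 := by
  obtain ⟨r, hr⟩ := exists_points_of_winning winning_triangleGame
  let k : Fin 11 := 8
  refine ⟨r k, fun i => r (k.succAbove i), fun f hdeg hp hq => hr f (fun s hs => ?_) ?_⟩
  · have := (le_totalDegree hs).trans hdeg
    rw [Finsupp.sum_fintype _ _ (fun _ => rfl), Fin.sum_univ_two] at this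
    exact mem_triangle.2 (by simpa using Nat.lt_succ_of_le this)
  · refine (Fin.forall_iff_succAbove (n := 10) k).2 ⟨hp, fun i => ?_⟩
    have hm : (triangleGame.get (k.succAbove i)).m = 7 := by
      fin_cases i <;> rfl
    rw [hm]
    exact hq i
end
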